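/- arXiv:2009.08806 — 8 statements merged into one kernel-verified Lean document; each statement's English description precedes it below -/
import Mathlib

section
/- Let G be a connected graph with vertex set {v_1,…,v_n} satisfying γ(G) ≥ 4, and let ℓ ≥ 1 be an integer. Let G' be the graph with vertex set {x_1,…,x_{2ℓ}} ∪ V_0 ∪ V_1 ∪ … ∪ V_{2ℓ}, where each V_i = {v_1^i,…,v_n^i} is a disjoint copy of V(G), and with exactly the following edges: V_0 induces a clique; for each 1 ≤ i ≤ 2ℓ the set V_i is independent and, for each 1 ≤ j ≤ n, the vertex v_j^i is adjacent exactly to those vertices v_k^0 with v_k ∈ N_G[v_j]; for each 1 ≤ i ≤ 2ℓ the vertex x_i is adjacent to every vertex of V_0 ∪ V_i; and x_i is adjacent to x_{i+1} for every odd i with 1 ≤ i < 2ℓ. Then γ(G) ≤ 2ℓ if and only if G' has a minimum total dominating set that contains a P3. -/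
open SimpleGraph

namespace TD

variable {V : Type*} {α β : Type*}

/-- `D` is a total dominating set of `G`: every vertex has a neighbor in `D`. -/
def IsTotalDomSet (G : SimpleGraph V) (D : Set V) : Prop :=
  ∀ v : V, ∃ u ∈ D, G.Adj v u

/-- The total domination number `γ_t(G)`. -/
noncomputable def totalDomNum (G : SimpleGraph V) : ℕ :=
  sInf {m : ℕ | ∃ D : Set V, IsTotalDomSet G D ∧ D.ncard = m}

/-- A minimum total dominating set. -/
def IsMinTotalDomSet (G : SimpleGraph V) (D : Set V) : Prop :=
  IsTotalDomSet G D ∧ D.ncard = totalDomNum G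

/-- `S` contains a `P3`: three distinct vertices `a, b, c ∈ S` with `ab, bc ∈ E(G)`. -/
def HasP3 (G : SimpleGraph V) (S : Set V) : Prop :=
  ∃ a b c : V, a ∈ S ∧ b ∈ S ∧ c ∈ S ∧ a ≠ b ∧ b ≠ c ∧ a ≠ c ∧ G.Adj a b ∧ G.Adj b c

/-- `D` is a dominating set of `G`. -/
def IsDomSet (G : SimpleGraph V) (D : Set V) : Prop :=
  ∀ v ∉ D, ∃ u ∈ D, G.Adj v u

/-- The domination number `γ(G)`. -/
noncomputable def domNum (G : SimpleGraph V) : ℕ :=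
  sInf {m : ℕ | ∃ D : Set V, IsDomSet G D ∧ D.ncard = m}

/-- The (open) neighborhood of a set `S`: union of the neighborhoods of its members. -/
def nbhd (G : SimpleGraph V) (S : Set V) : Set V :=
  {v | ∃ u ∈ S, G.Adj u v}

/-- The closed neighborhood `N[S]`. -/
def closedNbhd (G : SimpleGraph V) (S : Set V) : Set V :=
  S ∪ nbhd G S

/-- Distance between two sets of vertices. -/
noncomputable def setDist (G : SimpleGraph V) (S T : Set V) : ℕ :=
  sInf {m : ℕ | ∃ u ∈ S, ∃ v ∈ T, G.dist u v = m}

/-- `k` disjoint copies of `H`. -/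
def kCopies (k : ℕ) (H : SimpleGraph α) : SimpleGraph (Fin k × α) where
  Adj p q := p.1 = q.1 ∧ H.Adj p.2 q.2
  symm := ⟨fun _ _ h => ⟨h.1.symm, h.2.symm⟩⟩
  loopless := ⟨fun p h => H.loopless.irrefl p.2 h.2⟩

/-- The graph `P4 + k·P3`. -/
def p4kp3 (k : ℕ) : SimpleGraph (Fin 4 ⊕ (Fin k × Fin 3)) :=
  (pathGraph 4) ⊕g (kCopies k (pathGraph 3))

/-- `G` contains no induced copy of `H` (`G` is `H`-free). -/
def IndFree (G : SimpleGraph V) (H : SimpleGraph α) : Prop :=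
  ¬ Nonempty (H ↪g G)

/-- `K` is a maximal clique of the subgraph of `G` induced by `C`. -/
def IsMaxCliqueWithin (G : SimpleGraph V) (C K : Set V) : Prop :=
  K ⊆ C ∧ G.IsClique K ∧ ∀ K' : Set V, K' ⊆ C → G.IsClique K' → K ⊆ K' → K' = K

/-- Member of `𝒦'`: a maximal clique of `G[C]` whose closed neighborhood contains no
induced `P4` and such that no vertex of `B` is adjacent to all of its vertices. -/
def GoodClique (G : SimpleGraph V) (B C K : Set V) : Prop :=
  IsMaxCliqueWithin G C K ∧
    IndFree (G.induce (closedNbhd G K)) (pathGraph 4) ∧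
    ¬ ∃ b ∈ B, ∀ x ∈ K, G.Adj b x

/-- A regular clique: a member of `𝒦'` for which there are `k` other members of `𝒦'`
pairwise at distance at least four from one another and from it. -/
def RegularClique (G : SimpleGraph V) (k : ℕ) (B C K : Set V) : Prop :=
  GoodClique G B C K ∧
    ∃ Ks : Fin k → Set V,
      (∀ i, GoodClique G B C (Ks i)) ∧
      (∀ i, 4 ≤ setDist G K (Ks i)) ∧
      ∀ i j : Fin k, i ≠ j → 4 ≤ setDist G (Ks i) (Ks j)

/-- `w` is a private neighbor of `v` with respect to `D`: `N(w) ∩ D = {v}`. -/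
def IsPrivateNbr (G : SimpleGraph V) (D : Set V) (v w : V) : Prop :=
  {u | u ∈ D ∧ G.Adj w u} = {v}

end TD

open TD SimpleGraph


/-- The adjacency relation of the graph `G'` built from `G` and `ℓ`:
`Sum.inl i` is the vertex `x_{i+1}` (for `i : Fin (2ℓ)`), and `Sum.inr (i, j)` is
the vertex `v_{j+1}^{i}` of the copy `V_i` (for `i : Fin (2ℓ+1)`). -/
def gPrimeAdj (n ℓ : ℕ) (G : SimpleGraph (Fin n)) :
    Fin (2 * ℓ) ⊕ Fin (2 * ℓ + 1) × Fin n → Fin (2 * ℓ) ⊕ Fin (2 * ℓ + 1) × Fin n → Prop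
  | Sum.inl i, Sum.inl i' =>
      ((i : ℕ) % 2 = 0 ∧ (i' : ℕ) = (i : ℕ) + 1) ∨
      ((i' : ℕ) % 2 = 0 ∧ (i : ℕ) = (i' : ℕ) + 1)
  | Sum.inl i, Sum.inr (i', _) => i' = 0 ∨ (i' : ℕ) = (i : ℕ) + 1
  | Sum.inr (i', _), Sum.inl i => i' = 0 ∨ (i' : ℕ) = (i : ℕ) + 1
  | Sum.inr (i, j), Sum.inr (i', j') =>
      (i = 0 ∧ i' = 0 ∧ j ≠ j') ∨
      (i ≠ 0 ∧ i' = 0 ∧ (G.Adj j j' ∨ j = j')) ∨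
      (i = 0 ∧ i' ≠ 0 ∧ (G.Adj j' j ∨ j = j'))

namespace TD

lemma domNum_le_ncard {V : Type*} {G : SimpleGraph V} {D : Set V} (hD : IsDomSet G D) :
    domNum G ≤ D.ncard :=
  Nat.sInf_le ⟨D, hD, rfl⟩

lemma exists_isDomSet_ncard_eq_domNum {V : Type*} (G : SimpleGraph V) :
    ∃ D : Set V, IsDomSet G D ∧ D.ncard = domNum G :=
  Nat.sInf_mem (s := {m : ℕ | ∃ D : Set V, IsDomSet G D ∧ D.ncard = m})
    ⟨_, Set.univ, fun v hv => absurd (Set.mem_univ v) hv, rfl⟩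

lemma totalDomNum_le_ncard {V : Type*} {G : SimpleGraph V} {D : Set V}
    (hD : IsTotalDomSet G D) : totalDomNum G ≤ D.ncard :=
  Nat.sInf_le ⟨D, hD, rfl⟩

lemma IsTotalDomSet.le_totalDomNum {V : Type*} {G : SimpleGraph V} {D : Set V} {m : ℕ}
    (hD : IsTotalDomSet G D) (h : ∀ E : Set V, IsTotalDomSet G E → m ≤ E.ncard) :
    m ≤ totalDomNum G := by
  obtain ⟨E, hE, hcard⟩ := Nat.sInf_mem
    (s := {m : ℕ | ∃ D : Set V, IsTotalDomSet G D ∧ D.ncard = m}) ⟨_, D, hD, rfl⟩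
  exact (h E hE).trans hcard.le

end TD

section GPrime

variable {n ℓ : ℕ} {G : SimpleGraph (Fin n)}
  {G' : SimpleGraph (Fin (2 * ℓ) ⊕ Fin (2 * ℓ + 1) × Fin n)}

lemma ncard_range_inl :
    (Set.range (Sum.inl : Fin (2 * ℓ) → Fin (2 * ℓ) ⊕ Fin (2 * ℓ + 1) × Fin n)).ncard
      = 2 * ℓ := by
  rw [← Set.image_univ, Set.ncard_image_of_injective _ Sum.inl_injective, Set.ncard_univ,
    Nat.card_eq_fintype_card, Fintype.card_fin]

/-- A total dominating set of `G'` contains every `x_i` or dominates `G` from within `V_0`. -/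
lemma range_inl_subset_or_domNum_le (hadj : ∀ u v, G'.Adj u v ↔ gPrimeAdj n ℓ G u v)
    {D : Set (Fin (2 * ℓ) ⊕ Fin (2 * ℓ + 1) × Fin n)} (hD : IsTotalDomSet G' D) :
    Set.range Sum.inl ⊆ D ∨ domNum G ≤ D.ncard := by
  refine or_iff_not_imp_left.2 fun hx => ?_
  obtain ⟨_, ⟨i, rfl⟩, hi⟩ := Set.not_subset.1 hx
  let f : Fin n → Fin (2 * ℓ) ⊕ Fin (2 * ℓ + 1) × Fin n := fun j => Sum.inr (0, j)
  have hf : Function.Injective f := fun a b h => by simpa [f] using h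
  have hdom : IsDomSet G (f ⁻¹' D) := by
    intro j hj
    obtain ⟨i' | ⟨i', j'⟩, hu, huv⟩ := hD (Sum.inr (i.succ, j))
    · rw [hadj] at huv
      simp only [gPrimeAdj, Fin.succ_ne_zero, false_or, Fin.val_succ, add_left_inj] at huv
      rw [Fin.ext huv] at hi
      exact absurd hu hi
    · rw [hadj] at huv
      simp only [gPrimeAdj, Fin.succ_ne_zero, false_and, false_or, or_false, ne_eq,
        not_false_eq_true, true_and] at huv
      obtain ⟨rfl, h | rfl⟩ := huv
      · exact ⟨j', hu, h⟩
      · exact absurd hu hj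
  calc domNum G ≤ (f ⁻¹' D).ncard := domNum_le_ncard hdom
    _ = (f '' (f ⁻¹' D)).ncard := (Set.ncard_image_of_injective _ hf).symm
    _ ≤ D.ncard := Set.ncard_le_ncard (Set.image_preimage_subset _ _) D.toFinite

lemma isTotalDomSet_range_inl (hℓ : 1 ≤ ℓ) (hadj : ∀ u v, G'.Adj u v ↔ gPrimeAdj n ℓ G u v) :
    IsTotalDomSet G' (Set.range Sum.inl) := by
  rintro (i | ⟨i, j⟩)
  · rcases Nat.mod_two_eq_zero_or_one i with h | h
    · exact ⟨_, ⟨⟨i + 1, by omega⟩, rfl⟩, (hadj _ _).2 (Or.inl ⟨h, rfl⟩)⟩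
    · refine ⟨_, ⟨⟨i - 1, by omega⟩, rfl⟩, (hadj _ _).2 (Or.inr ⟨?_, ?_⟩)⟩ <;> simp only <;> omega
  · by_cases h : i = 0
    · exact ⟨_, ⟨⟨0, by omega⟩, rfl⟩, (hadj _ _).2 (Or.inl h)⟩
    · have := Fin.val_ne_zero_iff.2 h
      refine ⟨_, ⟨⟨i - 1, by omega⟩, rfl⟩, (hadj _ _).2 (Or.inr ?_)⟩
      simp only
      omega

lemma IsDomSet.isTotalDomSet_image_inr (hadj : ∀ u v, G'.Adj u v ↔ gPrimeAdj n ℓ G u v)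
    {D : Set (Fin n)} (hD : IsDomSet G D) (hcard : 1 < D.ncard) :
    IsTotalDomSet G' ((fun j => Sum.inr (0, j)) '' D) := by
  rintro (i | ⟨i, j⟩)
  · obtain ⟨a, ha⟩ := Set.nonempty_of_ncard_ne_zero (by omega : D.ncard ≠ 0)
    exact ⟨_, ⟨a, ha, rfl⟩, (hadj _ _).2 (Or.inl rfl)⟩
  · by_cases h : i = 0
    · obtain ⟨a, ha, hne⟩ := Set.exists_ne_of_one_lt_ncard hcard j
      exact ⟨_, ⟨a, ha, rfl⟩, (hadj _ _).2 (Or.inl ⟨h, rfl, hne.symm⟩)⟩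
    · by_cases hj : j ∈ D
      · exact ⟨_, ⟨j, hj, rfl⟩, (hadj _ _).2 (Or.inr (Or.inl ⟨h, rfl, Or.inr rfl⟩))⟩
      · obtain ⟨a, ha, hja⟩ := hD j hj
        exact ⟨_, ⟨a, ha, rfl⟩, (hadj _ _).2 (Or.inr (Or.inl ⟨h, rfl, Or.inl hja⟩))⟩

lemma not_hasP3_range_inl (hadj : ∀ u v, G'.Adj u v ↔ gPrimeAdj n ℓ G u v) :
    ¬ HasP3 G' (Set.range Sum.inl) := by
  rintro ⟨_, _, _, ⟨a, rfl⟩, ⟨b, rfl⟩, ⟨c, rfl⟩, -, -, hac, hab, hbc⟩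
  rw [hadj] at hab hbc
  simp only [gPrimeAdj] at hab hbc
  exact hac (congrArg Sum.inl (Fin.ext (by omega)))

end GPrime

theorem stmt1 (n ℓ : ℕ) (hℓ : 1 ≤ ℓ) (G : SimpleGraph (Fin n)) (hconn : G.Connected)
    (hγ : 4 ≤ domNum G)
    (G' : SimpleGraph (Fin (2 * ℓ) ⊕ Fin (2 * ℓ + 1) × Fin n))
    (hadj : ∀ u v, G'.Adj u v ↔ gPrimeAdj n ℓ G u v) :
    domNum G ≤ 2 * ℓ ↔ ∃ D, IsMinTotalDomSet G' D ∧ HasP3 G' D := by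
  constructor
  · intro hle
    obtain ⟨D, hD, hcard⟩ := exists_isDomSet_ncard_eq_domNum G
    have hinj : Function.Injective
        (fun j => Sum.inr (0, j) : Fin n → Fin (2 * ℓ) ⊕ Fin (2 * ℓ + 1) × Fin n) :=
      fun a b h => by simpa using h
    have htot := IsDomSet.isTotalDomSet_image_inr hadj hD (by omega)
    have hcard' := (Set.ncard_image_of_injective D hinj).trans hcard
    refine ⟨_, ⟨htot, le_antisymm ?_ (totalDomNum_le_ncard htot)⟩, ?_⟩
    · rw [hcard']
      refine htot.le_totalDomNum fun E hE => ?_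
      rcases range_inl_subset_or_domNum_le hadj hE with h | h
      · exact hle.trans (ncard_range_inl.symm.trans_le (Set.ncard_le_ncard h E.toFinite))
      · exact h
    · obtain ⟨a, b, c, ha, hb, hc, hab, hac, hbc⟩ :=
        (Set.two_lt_ncard_iff D.toFinite).1 (by omega : 2 < D.ncard)
      exact ⟨_, _, _, ⟨a, ha, rfl⟩, ⟨b, hb, rfl⟩, ⟨c, hc, rfl⟩, hinj.ne hab, hinj.ne hbc,
        hinj.ne hac, (hadj _ _).2 (Or.inl ⟨rfl, rfl, hab⟩), (hadj _ _).2 (Or.inl ⟨rfl, rfl, hbc⟩)⟩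
  · rintro ⟨D, ⟨hD, hcard⟩, hP3⟩
    have hle : D.ncard ≤ 2 * ℓ :=
      (hcard.trans_le (totalDomNum_le_ncard (isTotalDomSet_range_inl hℓ hadj))).trans_eq
        ncard_range_inl
    rcases range_inl_subset_or_domNum_le hadj hD with h | h
    · rw [← Set.eq_of_subset_of_ncard_le h (hle.trans_eq ncard_range_inl.symm) D.toFinite] at hP3
      exact absurd hP3 (not_hasP3_range_inl hadj)
    · exact h.trans hle
end

section
/- Let Φ be a 3-SAT instance with variable set X and nonempty clause set C, where each clause consists of exactly three literals over pairwise distinct variables. Let G_Φ be the graph constructed as follows: for each variable x ∈ X introduce four vertices x, x̄, u_x, v_x with the edges x x̄, x u_x, x̄ u_x, and u_x v_x; for each clause c ∈ C introduce a clause vertex c adjacent exactly to the literal vertices (positive literal vertex x or negative literal vertex x̄) whose corresponding literal occurs in c; and add an edge between every two clause vertices, so that the clause vertices form a clique. Then Φ is satisfiable if and only if γ_t(G_Φ) = 2|X|. -/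
open SimpleGraph

open TD SimpleGraph


/-- The adjacency relation of the graph `G_Φ`: for a variable `x`, `Sum.inl (x, 0)` is the
positive literal vertex `x`, `Sum.inl (x, 1)` is the negative literal vertex `x̄`,
`Sum.inl (x, 2)` is `u_x`, `Sum.inl (x, 3)` is `v_x`; `Sum.inr c` is the clause vertex `c`. -/
def satAdj {X C : Type*} (lit : C → Fin 3 → X × Bool) :
    X × Fin 4 ⊕ C → X × Fin 4 ⊕ C → Prop
  | Sum.inl (x, a), Sum.inl (y, b) =>
      x = y ∧ ((a = 0 ∧ b = 1) ∨ (a = 1 ∧ b = 0) ∨ (a = 0 ∧ b = 2) ∨ (a = 2 ∧ b = 0) ∨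
        (a = 1 ∧ b = 2) ∨ (a = 2 ∧ b = 1) ∨ (a = 2 ∧ b = 3) ∨ (a = 3 ∧ b = 2))
  | Sum.inl (x, a), Sum.inr c =>
      ((∃ i, lit c i = (x, true)) ∧ a = 0) ∨ ((∃ i, lit c i = (x, false)) ∧ a = 1)
  | Sum.inr c, Sum.inl (x, a) =>
      ((∃ i, lit c i = (x, true)) ∧ a = 0) ∨ ((∃ i, lit c i = (x, false)) ∧ a = 1)
  | Sum.inr c, Sum.inr c' => c ≠ c'

/-- The vertex set consisting of `u_x` and the vertex `(x, w x)` for every variable `x`. -/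
def gadgetSet {X : Type*} (C : Type*) (w : X → Fin 4) : Set (X × Fin 4 ⊕ C) :=
  Set.range fun p : X × Bool => Sum.inl (p.1, if p.2 then 2 else w p.1)

theorem hub_mem_gadgetSet {X : Type*} (C : Type*) (w : X → Fin 4) (x : X) :
    Sum.inl (x, 2) ∈ gadgetSet C w :=
  ⟨(x, true), by simp⟩

theorem choice_mem_gadgetSet {X : Type*} (C : Type*) (w : X → Fin 4) (x : X) :
    Sum.inl (x, w x) ∈ gadgetSet C w :=
  ⟨(x, false), by simp⟩

theorem ncard_gadgetSet {X : Type*} [Fintype X] (C : Type*) {w : X → Fin 4}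
    (hw : ∀ x, w x ≠ 2) : (gadgetSet C w).ncard = 2 * Fintype.card X := by
  have hinj : Function.Injective
      fun p : X × Bool => (Sum.inl (p.1, if p.2 then 2 else w p.1) : X × Fin 4 ⊕ C) := by
    rintro ⟨x, b⟩ ⟨y, b'⟩ h
    obtain ⟨rfl, h⟩ := Prod.mk.inj (Sum.inl.inj h)
    cases b <;> cases b' <;> simp_all [eq_comm]
  rw [gadgetSet, ← Set.image_univ, Set.ncard_image_of_injective _ hinj, Set.ncard_univ,
    Nat.card_eq_fintype_card, Fintype.card_prod, Fintype.card_bool, mul_comm]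

/-- Every total dominating set of `G_Φ` contains `u_x` and one of its neighbors, for each `x`. -/
theorem exists_gadgetSet_subset {X C : Type*} {lit : C → Fin 3 → X × Bool}
    {G : SimpleGraph (X × Fin 4 ⊕ C)} (hadj : ∀ u v, G.Adj u v ↔ satAdj lit u v)
    {D : Set (X × Fin 4 ⊕ C)} (hD : IsTotalDomSet G D) :
    ∃ w : X → Fin 4, (∀ x, w x ≠ 2) ∧ gadgetSet C w ⊆ D := by
  have hhub : ∀ x, Sum.inl (x, 2) ∈ D := by
    intro x
    obtain ⟨⟨y, b⟩ | c, hu, h⟩ := hD (Sum.inl (x, 3))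
    · rw [hadj] at h
      obtain ⟨rfl, h⟩ := h
      have hb : b = 2 := by simpa using h
      exact hb ▸ hu
    · rw [hadj] at h
      simp [satAdj] at h
  have hnbr : ∀ x, ∃ a : Fin 4, a ≠ 2 ∧ Sum.inl (x, a) ∈ D := by
    intro x
    obtain ⟨⟨y, b⟩ | c, hu, h⟩ := hD (Sum.inl (x, 2))
    · rw [hadj] at h
      obtain ⟨rfl, h⟩ := h
      refine ⟨b, ?_, hu⟩
      rintro rfl
      simp at h
    · rw [hadj] at h
      simp [satAdj] at h
  choose w hw hwD using hnbr
  refine ⟨w, hw, ?_⟩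
  rintro _ ⟨⟨x, _ | _⟩, rfl⟩
  · simpa using hwD x
  · simpa using hhub x

theorem two_mul_card_le_ncard {X C : Type*} [Fintype X] [Finite C] {lit : C → Fin 3 → X × Bool}
    {G : SimpleGraph (X × Fin 4 ⊕ C)} (hadj : ∀ u v, G.Adj u v ↔ satAdj lit u v)
    {D : Set (X × Fin 4 ⊕ C)} (hD : IsTotalDomSet G D) : 2 * Fintype.card X ≤ D.ncard := by
  obtain ⟨w, hw, hsub⟩ := exists_gadgetSet_subset hadj hD
  rw [← ncard_gadgetSet C hw]
  exact Set.ncard_le_ncard hsub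

/-- A satisfying assignment selects literal vertices that, with all `u_x`, totally dominate. -/
theorem isTotalDomSet_gadgetSet_of_satisfies {X C : Type*} {lit : C → Fin 3 → X × Bool}
    {G : SimpleGraph (X × Fin 4 ⊕ C)} (hadj : ∀ u v, G.Adj u v ↔ satAdj lit u v)
    {σ : X → Bool} (hσ : ∀ c : C, ∃ i : Fin 3, σ (lit c i).1 = (lit c i).2) :
    IsTotalDomSet G (gadgetSet C fun x => if σ x then 0 else 1) := by
  rintro (⟨x, a⟩ | c)
  · by_cases ha : a = 2
    · refine ⟨_, choice_mem_gadgetSet C _ x, ?_⟩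
      rw [hadj]
      cases σ x <;> simp [satAdj, ha]
    · refine ⟨_, hub_mem_gadgetSet C _ x, ?_⟩
      rw [hadj]
      fin_cases a <;> simp_all [satAdj]
  · obtain ⟨i, hi⟩ := hσ c
    refine ⟨_, choice_mem_gadgetSet C _ (lit c i).1, ?_⟩
    rw [hadj]
    cases h : σ (lit c i).1
    · exact Or.inr ⟨⟨i, Prod.ext rfl (hi.symm.trans h)⟩, by simp⟩
    · exact Or.inl ⟨⟨i, Prod.ext rfl (hi.symm.trans h)⟩, by simp⟩

theorem satisfiable_of_isTotalDomSet_gadgetSet {X C : Type*} {lit : C → Fin 3 → X × Bool}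
    {G : SimpleGraph (X × Fin 4 ⊕ C)} (hadj : ∀ u v, G.Adj u v ↔ satAdj lit u v)
    {w : X → Fin 4} (hD : IsTotalDomSet G (gadgetSet C w)) :
    ∃ σ : X → Bool, ∀ c : C, ∃ i : Fin 3, σ (lit c i).1 = (lit c i).2 := by
  refine ⟨fun x => decide (w x = 0), fun c => ?_⟩
  obtain ⟨_, ⟨⟨x, b⟩, rfl⟩, h⟩ := hD (Sum.inr c)
  rw [hadj] at h
  obtain ⟨⟨i, hi⟩, h⟩ | ⟨⟨i, hi⟩, h⟩ := h <;> refine ⟨i, ?_⟩ <;> cases b <;> simp_all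

theorem stmt2 {X C : Type*} [Fintype X] [Fintype C] [Nonempty C]
    (lit : C → Fin 3 → X × Bool)
    (hdistinct : ∀ c : C, Function.Injective fun i : Fin 3 => (lit c i).1)
    (GΦ : SimpleGraph (X × Fin 4 ⊕ C))
    (hadj : ∀ u v, GΦ.Adj u v ↔ satAdj lit u v) :
    (∃ σ : X → Bool, ∀ c : C, ∃ i : Fin 3, σ (lit c i).1 = (lit c i).2) ↔
      totalDomNum GΦ = 2 * Fintype.card X := by
  constructor
  · rintro ⟨σ, hσ⟩
    have hmem : 2 * Fintype.card X ∈ {m | ∃ D, IsTotalDomSet GΦ D ∧ D.ncard = m} :=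
      ⟨_, isTotalDomSet_gadgetSet_of_satisfies hadj hσ,
        ncard_gadgetSet C fun x => by cases σ x <;> simp⟩
    refine le_antisymm (Nat.sInf_le hmem) (le_csInf ⟨_, hmem⟩ ?_)
    rintro _ ⟨D, hD, rfl⟩
    exact two_mul_card_le_ncard hadj hD
  · intro h
    have : Nonempty X := ‹Nonempty C›.map fun c => (lit c 0).1
    have hpos : 0 < totalDomNum GΦ := h ▸ Nat.mul_pos two_pos Fintype.card_pos
    obtain ⟨D, hD, hcard⟩ := Nat.sInf_mem (Nat.nonempty_of_pos_sInf hpos)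
    obtain ⟨w, hw, hsub⟩ := exists_gadgetSet_subset hadj hD
    have heq : gadgetSet C w = D := Set.eq_of_subset_of_ncard_le hsub
      ((hcard.trans h).trans (ncard_gadgetSet C hw).symm).le
    exact satisfiable_of_isTotalDomSet_gadgetSet hadj (heq ▸ hD)
end

section
/- Let Φ be a 3-SAT instance with variable set X and nonempty clause set C, where each clause consists of exactly three literals over pairwise distinct variables. Let G_Φ be the graph constructed as follows: for each variable x ∈ X introduce four vertices x, x̄, u_x, v_x with the edges x x̄, x u_x, x̄ u_x, and u_x v_x; for each clause c ∈ C introduce a clause vertex c adjacent exactly to the literal vertices (positive literal vertex x or negative literal vertex x̄) whose corresponding literal occurs in c; and add an edge between every two clause vertices, so that the clause vertices form a clique. Then γ_t(G_Φ) = 2|X| if and only if no minimum total dominating set of G_Φ contains a P3. -/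
open SimpleGraph

open TD SimpleGraph


/-- The vertices `u_x` together with one further vertex `g x` of every variable gadget. -/
def gadgetPairs {X C : Type*} (g : X → Fin 4) : Set (X × Fin 4 ⊕ C) :=
  Set.range fun p : X × Bool => Sum.inl (p.1, if p.2 then 2 else g p.1)

theorem inl_mem_gadgetPairs {X C : Type*} {g : X → Fin 4} {x : X} {a : Fin 4} :
    (Sum.inl (x, a) : X × Fin 4 ⊕ C) ∈ gadgetPairs g ↔ a = 2 ∨ a = g x := by
  simp only [gadgetPairs, Set.mem_range, Sum.inl.injEq, Prod.mk.injEq, Prod.exists, Bool.exists_bool]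
  constructor
  · rintro ⟨y, ⟨rfl, h⟩ | ⟨rfl, h⟩⟩ <;> simp_all
  · rintro (rfl | rfl) <;> exact ⟨x, by simp⟩

theorem inr_notMem_gadgetPairs {X C : Type*} {g : X → Fin 4} {c : C} :
    (Sum.inr c : X × Fin 4 ⊕ C) ∉ gadgetPairs g := by
  simp [gadgetPairs]

theorem ncard_gadgetPairs {X C : Type*} [Fintype X] {g : X → Fin 4} (hg : ∀ x, g x ≠ 2) :
    (gadgetPairs g : Set (X × Fin 4 ⊕ C)).ncard = 2 * Fintype.card X := by
  have hinj : Function.Injective fun p : X × Bool =>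
      (Sum.inl (p.1, if p.2 then 2 else g p.1) : X × Fin 4 ⊕ C) := by
    rintro ⟨x, b⟩ ⟨y, b'⟩ h
    have := hg x
    have := (hg x).symm
    cases b <;> cases b' <;> simp_all
  rw [gadgetPairs, Set.ncard_range_of_injective hinj, Nat.card_eq_fintype_card,
    Fintype.card_prod, Fintype.card_bool, mul_comm]

theorem exists_gadgetPairs_subset {X C : Type*} {lit : C → Fin 3 → X × Bool}
    {G : SimpleGraph (X × Fin 4 ⊕ C)} (hadj : ∀ u v, G.Adj u v ↔ satAdj lit u v)
    {D : Set (X × Fin 4 ⊕ C)} (hD : IsTotalDomSet G D) :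
    ∃ g : X → Fin 4, (∀ x, g x ≠ 2) ∧ gadgetPairs g ⊆ D := by
  have hu : ∀ x, Sum.inl (x, 2) ∈ D := by
    intro x
    obtain ⟨⟨y, b⟩ | c, hw, ha⟩ := hD (Sum.inl (x, 3))
    · rw [hadj] at ha
      simp only [satAdj] at ha
      obtain ⟨rfl, ha⟩ := ha
      have : b = 2 := by simpa using ha
      rwa [← this]
    · rw [hadj] at ha
      simp [satAdj] at ha
  have hp : ∀ x, ∃ b : Fin 4, b ≠ 2 ∧ Sum.inl (x, b) ∈ D := by
    intro x
    obtain ⟨⟨y, b⟩ | c, hw, ha⟩ := hD (Sum.inl (x, 2))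
    · rw [hadj] at ha
      simp only [satAdj] at ha
      obtain ⟨rfl, ha⟩ := ha
      refine ⟨b, ?_, hw⟩
      rintro rfl
      simp at ha
    · rw [hadj] at ha
      simp [satAdj] at ha
  choose g hg hgD using hp
  refine ⟨g, hg, ?_⟩
  rintro _ ⟨⟨x, b⟩, rfl⟩
  cases b <;> simp [hu, hgD]

theorem not_hasP3_gadgetPairs {X C : Type*} {lit : C → Fin 3 → X × Bool}
    {G : SimpleGraph (X × Fin 4 ⊕ C)} (hadj : ∀ u v, G.Adj u v ↔ satAdj lit u v)
    (g : X → Fin 4) : ¬ HasP3 G (gadgetPairs g) := by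
  rintro ⟨⟨x, a⟩ | _, ⟨y, b⟩ | _, ⟨z, c⟩ | _, ha, hb, hc, hab, hbc, hac, h₁, h₂⟩ <;>
    try exact absurd ‹_› inr_notMem_gadgetPairs
  rw [hadj] at h₁ h₂
  obtain ⟨rfl, -⟩ := h₁
  obtain ⟨rfl, -⟩ := h₂
  rw [inl_mem_gadgetPairs] at ha hb hc
  simp only [ne_eq, Sum.inl.injEq, Prod.mk.injEq, true_and] at hab hbc hac
  grind

theorem totalDomNum_le {V : Type*} {G : SimpleGraph V} {D : Set V} (hD : IsTotalDomSet G D) :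
    totalDomNum G ≤ D.ncard :=
  Nat.sInf_le ⟨D, hD, rfl⟩

theorem TD.IsTotalDomSet.exists_isMinTotalDomSet {V : Type*} {G : SimpleGraph V} {D : Set V}
    (hD : IsTotalDomSet G D) : ∃ E, IsMinTotalDomSet G E :=
  Nat.sInf_mem (s := {m : ℕ | ∃ D : Set V, IsTotalDomSet G D ∧ D.ncard = m}) ⟨_, D, hD, rfl⟩

/-- Adding one clause vertex to a choice of literals satisfying that clause gives a total
dominating set containing a `P3`. -/
theorem exists_isTotalDomSet_hasP3 {X C : Type*} [Fintype X] [Fintype C] [Nonempty C]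
    {lit : C → Fin 3 → X × Bool} {G : SimpleGraph (X × Fin 4 ⊕ C)}
    (hadj : ∀ u v, G.Adj u v ↔ satAdj lit u v) :
    ∃ D, IsTotalDomSet G D ∧ HasP3 G D ∧ D.ncard = 2 * Fintype.card X + 1 := by
  classical
  obtain ⟨c₀⟩ := ‹Nonempty C›
  obtain ⟨x₀, s, hs⟩ : ∃ x₀ s, lit c₀ 0 = (x₀, s) := ⟨_, _, rfl⟩
  set g : X → Fin 4 := fun _ => if s then 0 else 1 with hg
  have hg01 : ∀ x, g x = 0 ∨ g x = 1 := fun x => by cases s <;> simp [hg]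
  have hg2 : ∀ x, g x ≠ 2 := fun x => by rcases hg01 x with h | h <;> simp [h]
  have hmem_u : ∀ x, Sum.inl (x, 2) ∈ insert (Sum.inr c₀) (gadgetPairs g) := fun x =>
    Or.inr (inl_mem_gadgetPairs.2 (Or.inl rfl))
  have hmem_g : ∀ x, Sum.inl (x, g x) ∈ insert (Sum.inr c₀) (gadgetPairs g) := fun x =>
    Or.inr (inl_mem_gadgetPairs.2 (Or.inr rfl))
  have hclause : G.Adj (Sum.inr c₀) (Sum.inl (x₀, g x₀)) := by
    rw [hadj]
    cases s
    · exact Or.inr ⟨⟨0, hs⟩, by simp [hg]⟩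
    · exact Or.inl ⟨⟨0, hs⟩, by simp [hg]⟩
  have hug : ∀ x, G.Adj (Sum.inl (x, g x)) (Sum.inl (x, 2)) := fun x => by
    rw [hadj]
    rcases hg01 x with h | h <;> simp [satAdj, h]
  refine ⟨insert (Sum.inr c₀) (gadgetPairs g), ?_, ?_, ?_⟩
  · rintro (⟨x, a⟩ | c)
    · by_cases ha : a = 2
      · subst ha
        exact ⟨_, hmem_g x, (hug x).symm⟩
      · refine ⟨_, hmem_u x, ?_⟩
        rw [hadj]
        fin_cases a <;> simp_all [satAdj]
    · by_cases hc : c = c₀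
      · subst hc
        exact ⟨_, hmem_g x₀, hclause⟩
      · exact ⟨Sum.inr c₀, Or.inl rfl, (hadj _ _).2 hc⟩
  · exact ⟨_, _, _, Or.inl rfl, hmem_g x₀, hmem_u x₀, by simp, by simpa using hg2 x₀, by simp,
      hclause, hug x₀⟩
  · rw [Set.ncard_insert_of_notMem inr_notMem_gadgetPairs (Set.toFinite _),
      ncard_gadgetPairs hg2]

theorem stmt3 {X C : Type*} [Fintype X] [Fintype C] [Nonempty C]
    (lit : C → Fin 3 → X × Bool)
    (hdistinct : ∀ c : C, Function.Injective fun i : Fin 3 => (lit c i).1)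
    (GΦ : SimpleGraph (X × Fin 4 ⊕ C))
    (hadj : ∀ u v, GΦ.Adj u v ↔ satAdj lit u v) :
    totalDomNum GΦ = 2 * Fintype.card X ↔
      ∀ D : Set (X × Fin 4 ⊕ C), IsMinTotalDomSet GΦ D → ¬ HasP3 GΦ D := by
  obtain ⟨D₁, hD₁, hP, hcard⟩ := exists_isTotalDomSet_hasP3 hadj
  constructor
  · rintro hnum D ⟨hD, hDcard⟩
    obtain ⟨g, hg, hsub⟩ := exists_gadgetPairs_subset hadj hD
    rw [← Set.eq_of_subset_of_ncard_le hsub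
      (by rw [hDcard, hnum, ncard_gadgetPairs hg]) (Set.toFinite _)]
    exact not_hasP3_gadgetPairs hadj g
  · intro hno
    obtain ⟨E, hE, hEcard⟩ := hD₁.exists_isMinTotalDomSet
    obtain ⟨g, hg, hsub⟩ := exists_gadgetPairs_subset hadj hE
    have hlower := Set.ncard_le_ncard hsub (Set.toFinite _)
    rw [ncard_gadgetPairs hg, hEcard] at hlower
    have hupper := totalDomNum_le hD₁
    by_contra hne
    exact hno D₁ ⟨hD₁, by omega⟩ hP
end

section
/- Let G be a connected graph on at least three vertices and let G' be the graph obtained from G by 4-subdividing every edge, that is, each edge uv of G is replaced by a path u, e_1^{uv}, e_2^{uv}, e_3^{uv}, e_4^{uv}, v on four new vertices. Then γ_t(G') = γ_t(G) + 2|E(G)|, and G has a minimum total dominating set that contains a P3 if and only if G' has a minimum total dominating set that contains a P3. -/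
open SimpleGraph

open TD SimpleGraph


/-- The adjacency relation of the graph `G'` obtained from `G` by 4-subdividing every edge,
where `o` chooses an orientation of each edge: for an edge `e` oriented as `(u, v)`,
`Sum.inr (e, i)` is the subdivision vertex `e_{i+1}` (so `e_1` is adjacent to `u` and
`e_4` is adjacent to `v`). -/
def fullSubdivAdj {V : Type*} (G : SimpleGraph V) (o : G.edgeSet → V × V) :
    V ⊕ (↥G.edgeSet × Fin 4) → V ⊕ (↥G.edgeSet × Fin 4) → Prop
  | Sum.inl _, Sum.inl _ => False
  | Sum.inl a, Sum.inr (e, i) => (a = (o e).1 ∧ i = 0) ∨ (a = (o e).2 ∧ i = 3)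
  | Sum.inr (e, i), Sum.inl a => (a = (o e).1 ∧ i = 0) ∨ (a = (o e).2 ∧ i = 3)
  | Sum.inr (e, i), Sum.inr (e', j) =>
      e = e' ∧ ((j : ℕ) = (i : ℕ) + 1 ∨ (i : ℕ) = (j : ℕ) + 1)

namespace TD

section General

variable {W : Type*} {G : SimpleGraph V} {H : SimpleGraph W} {D : Set V}

theorem totalDomNum_le (hD : IsTotalDomSet G D) : totalDomNum G ≤ D.ncard :=
  Nat.sInf_le ⟨D, hD, rfl⟩

theorem IsTotalDomSet.exists_isMin (hD : IsTotalDomSet G D) : ∃ E, IsMinTotalDomSet G E :=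
  Nat.sInf_mem (s := {m : ℕ | ∃ D : Set V, IsTotalDomSet G D ∧ D.ncard = m}) ⟨_, D, hD, rfl⟩

theorem IsTotalDomSet.isMin (hD : IsTotalDomSet G D) (h : D.ncard ≤ totalDomNum G) :
    IsMinTotalDomSet G D :=
  ⟨hD, h.antisymm (totalDomNum_le hD)⟩

theorem IsTotalDomSet.image_iso (φ : G ≃g H) (hD : IsTotalDomSet G D) :
    IsTotalDomSet H (φ '' D) := by
  intro w
  obtain ⟨u, hu, hadj⟩ := hD (φ.symm w)
  refine ⟨φ u, ⟨u, hu, rfl⟩, ?_⟩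
  simpa using φ.map_adj_iff.2 hadj

theorem ncard_image_iso (φ : G ≃g H) (D : Set V) : (φ '' D).ncard = D.ncard :=
  Set.ncard_image_of_injective _ φ.injective

theorem HasP3.image_iso (φ : G ≃g H) (hD : HasP3 G D) : HasP3 H (φ '' D) := by
  obtain ⟨a, b, c, ha, hb, hc, hab, hbc, hac, h₁, h₂⟩ := hD
  exact ⟨φ a, φ b, φ c, ⟨a, ha, rfl⟩, ⟨b, hb, rfl⟩, ⟨c, hc, rfl⟩, φ.injective.ne hab,
    φ.injective.ne hbc, φ.injective.ne hac, φ.map_adj_iff.2 h₁, φ.map_adj_iff.2 h₂⟩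

theorem totalDomNum_congr (φ : G ≃g H) : totalDomNum G = totalDomNum H := by
  unfold totalDomNum
  congr 1
  ext m
  constructor
  · rintro ⟨D, hD, rfl⟩
    exact ⟨φ '' D, hD.image_iso φ, ncard_image_iso φ D⟩
  · rintro ⟨D, hD, rfl⟩
    exact ⟨φ.symm '' D, hD.image_iso φ.symm, ncard_image_iso φ.symm D⟩

theorem exists_isMin_hasP3_of_iso (φ : G ≃g H) (h : ∃ D, IsMinTotalDomSet G D ∧ HasP3 G D) :
    ∃ D, IsMinTotalDomSet H D ∧ HasP3 H D := by
  obtain ⟨D, ⟨hD, hc⟩, hP⟩ := h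
  exact ⟨φ '' D, ⟨hD.image_iso φ, by rw [ncard_image_iso, hc, totalDomNum_congr φ]⟩,
    hP.image_iso φ⟩

theorem hasP3_of_darts {d d' : G.Dart} (h : d.snd = d'.fst) (hne : d' ≠ d.symm)
    (h₁ : d.fst ∈ D) (h₂ : d.snd ∈ D) (h₃ : d'.snd ∈ D) : HasP3 G D := by
  refine ⟨d.fst, d.snd, d'.snd, h₁, h₂, h₃, d.adj.ne, h ▸ d'.adj.ne, fun he => hne ?_, d.adj,
    h ▸ d'.adj⟩
  exact SimpleGraph.Dart.ext _ _ (Prod.ext h.symm he.symm)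

theorem exists_dart_of_connected [Fintype V] (hconn : G.Connected) (hcard : 3 ≤ Fintype.card V)
    (d : G.Dart) : ∃ f : G.Dart, (f.fst = d.fst ∧ f ≠ d) ∨ (f.fst = d.snd ∧ f ≠ d.symm) := by
  classical
  have hlt : ({d.fst, d.snd} : Finset V).card < Fintype.card V :=
    (Finset.card_le_two).trans_lt hcard
  obtain ⟨x, hx⟩ : ∃ x, x ∉ ({d.fst, d.snd} : Finset V) := by
    by_contra! h
    exact hlt.ne (by rw [Finset.eq_univ_iff_forall.2 h, Finset.card_univ])
  obtain ⟨p⟩ := hconn.preconnected d.fst x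
  obtain ⟨f, -, hf₁, hf₂⟩ := p.exists_boundary_dart {d.fst, d.snd} (by simp) (by simpa using hx)
  simp only [Set.mem_insert_iff, Set.mem_singleton_iff, not_or] at hf₁ hf₂
  refine ⟨f, hf₁.imp (fun h => ⟨h, ?_⟩) (fun h => ⟨h, ?_⟩)⟩
  · rintro rfl
    exact hf₂.2 rfl
  · rintro rfl
    exact hf₂.1 rfl

theorem exists_dart_fst_eq [Fintype V] (hconn : G.Connected) (hcard : 3 ≤ Fintype.card V)
    (v : V) : ∃ d : G.Dart, d.fst = v := by
  have : Nontrivial V := Fintype.one_lt_card_iff_nontrivial.1 (by omega)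
  obtain ⟨w, hw⟩ := hconn.preconnected.exists_adj_of_nontrivial v
  exact ⟨⟨(v, w), hw⟩, rfl⟩

end General

/-- The 4-subdivision of `G`, without a choice of orientation: the subdivision vertex next to
`d.fst` on the edge of the dart `d` is `(d, false)`, and the one after it is `(d, true)`. -/
def dartSubdiv (G : SimpleGraph V) : SimpleGraph (V ⊕ G.Dart × Bool) where
  Adj
    | .inl _, .inl _ => False
    | .inl a, .inr (d, b) => a = d.fst ∧ b = false
    | .inr (d, b), .inl a => a = d.fst ∧ b = false
    | .inr (d, b), .inr (d', b') => (d = d' ∧ b ≠ b') ∨ (d' = d.symm ∧ b = true ∧ b' = true)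
  symm := ⟨by
    rintro (a | ⟨d, b⟩) (a' | ⟨d', b'⟩) h
    · exact h
    · exact h
    · exact h
    · rcases h with ⟨rfl, h⟩ | ⟨rfl, h, h'⟩
      · exact .inl ⟨rfl, h.symm⟩
      · exact .inr ⟨(SimpleGraph.Dart.symm_symm d).symm, h', h⟩⟩
  loopless := ⟨by
    rintro (a | ⟨d, b⟩) h
    · exact h
    · rcases h with ⟨-, h⟩ | ⟨h, -⟩
      · exact h rfl
      · exact d.symm_ne h.symm⟩

section DartSubdiv

variable {G : SimpleGraph V}

/-- The set of vertices of `dartSubdiv G` with given original, first and second vertices. -/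
def ofParts (X : Set V) (A B : Set G.Dart) : Set (V ⊕ G.Dart × Bool) :=
  {x | Sum.elim (· ∈ X) (fun p => bif p.2 then p.1 ∈ B else p.1 ∈ A) x}

@[simp] theorem inl_mem_ofParts {X : Set V} {A B : Set G.Dart} {v : V} :
    Sum.inl v ∈ ofParts X A B ↔ v ∈ X := Iff.rfl

@[simp] theorem inr_false_mem_ofParts {X : Set V} {A B : Set G.Dart} {d : G.Dart} :
    Sum.inr (d, false) ∈ ofParts X A B ↔ d ∈ A := Iff.rfl

@[simp] theorem inr_true_mem_ofParts {X : Set V} {A B : Set G.Dart} {d : G.Dart} :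
    Sum.inr (d, true) ∈ ofParts X A B ↔ d ∈ B := Iff.rfl

theorem exists_eq_ofParts (S : Set (V ⊕ G.Dart × Bool)) : ∃ X A B, S = ofParts X A B := by
  refine ⟨{v | .inl v ∈ S}, {d | .inr (d, false) ∈ S}, {d | .inr (d, true) ∈ S}, ?_⟩
  ext (v | ⟨d, _ | _⟩) <;> simp

theorem ncard_ofParts [Finite V] (X : Set V) (A B : Set G.Dart) :
    (ofParts X A B).ncard = X.ncard + A.ncard + B.ncard := by
  classical
  have : Fintype V := Fintype.ofFinite V
  have hf : Function.Injective fun d : G.Dart => (Sum.inr (d, false) : V ⊕ G.Dart × Bool) :=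
    fun d d' h => by simpa using h
  have ht : Function.Injective fun d : G.Dart => (Sum.inr (d, true) : V ⊕ G.Dart × Bool) :=
    fun d d' h => by simpa using h
  have : ofParts X A B = (Sum.inl '' X ∪ (fun d => Sum.inr (d, false)) '' A) ∪
      (fun d => Sum.inr (d, true)) '' B := by
    ext (v | ⟨d, _ | _⟩) <;> simp
  rw [this, Set.ncard_union_eq, Set.ncard_union_eq,
    Set.ncard_image_of_injective _ Sum.inl_injective, Set.ncard_image_of_injective _ hf,
    Set.ncard_image_of_injective _ ht]
  · rw [Set.disjoint_left]
    rintro _ ⟨v, -, rfl⟩ ⟨d, -, h⟩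
    simp at h
  · rw [Set.disjoint_left]
    rintro _ (⟨v, -, rfl⟩ | ⟨d, -, rfl⟩) ⟨d', -, h⟩ <;> simp at h

/-- The condition on `X`, `A`, `B` for `ofParts X A B` to be a total dominating set. -/
structure IsTotalDomParts (X : Set V) (A B : Set G.Dart) : Prop where
  exists_mem (v : V) : ∃ d ∈ A, d.fst = v
  fst_mem_or (d : G.Dart) : d.fst ∈ X ∨ d ∈ B
  mem_or (d : G.Dart) : d ∈ A ∨ d.symm ∈ B

theorem isTotalDomSet_ofParts_iff {X : Set V} {A B : Set G.Dart} :
    IsTotalDomSet (dartSubdiv G) (ofParts X A B) ↔ IsTotalDomParts X A B := by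
  constructor
  · intro h
    refine ⟨fun v => ?_, fun d => ?_, fun d => ?_⟩
    · obtain ⟨(w | ⟨d, _ | _⟩), hw, hadj⟩ := h (.inl v)
      · exact hadj.elim
      · exact ⟨d, hw, hadj.1.symm⟩
      · exact absurd hadj.2 (by simp)
    · obtain ⟨(w | ⟨d', _ | _⟩), hw, hadj⟩ := h (.inr (d, false))
      · exact .inl (hadj.1 ▸ hw)
      · simp [dartSubdiv] at hadj
      · have : d = d' := by simpa [dartSubdiv] using hadj
        exact .inr (this ▸ hw)
    · obtain ⟨(w | ⟨d', _ | _⟩), hw, hadj⟩ := h (.inr (d, true))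
      · simp [dartSubdiv] at hadj
      · have : d = d' := by simpa [dartSubdiv] using hadj
        exact .inl (this ▸ hw)
      · have : d' = d.symm := by simpa [dartSubdiv] using hadj
        exact .inr (this ▸ hw)
  · rintro ⟨h₁, h₂, h₃⟩ (v | ⟨d, _ | _⟩)
    · obtain ⟨d, hd, rfl⟩ := h₁ v
      exact ⟨.inr (d, false), hd, rfl, rfl⟩
    · rcases h₂ d with h | h
      · exact ⟨.inl d.fst, h, rfl, rfl⟩
      · exact ⟨.inr (d, true), h, .inl ⟨rfl, by simp⟩⟩
    · rcases h₃ d with h | h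
      · exact ⟨.inr (d, false), h, .inl ⟨rfl, by simp⟩⟩
      · exact ⟨.inr (d.symm, true), h, .inr ⟨rfl, rfl, rfl⟩⟩

theorem hasP3_ofParts {X : Set V} {A B : Set G.Dart}
    (h : HasP3 (dartSubdiv G) (ofParts X A B)) :
    (∃ d ∈ A, ∃ d' ∈ A, d.fst ∈ X ∧ d'.fst = d.fst ∧ d' ≠ d) ∨
      ∃ d ∈ A, d ∈ B ∧ (d.fst ∈ X ∨ d.symm ∈ B) := by
  obtain ⟨a, b, c, ha, hb, hc, hab, hbc, hac, h₁, h₂⟩ := h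
  rcases b with v | ⟨d, _ | _⟩ <;> rcases a with u | ⟨e, _ | _⟩ <;>
    rcases c with w | ⟨f, _ | _⟩ <;> simp [dartSubdiv] at * <;> grind [SimpleGraph.Dart.symm_symm]

/-- The canonical extension of a total dominating set of `G` to `dartSubdiv G`. -/
def extend (G : SimpleGraph V) (D : Set V) : Set (V ⊕ G.Dart × Bool) :=
  ofParts D {d | d.snd ∈ D} {d | d.fst ∉ D}

theorem IsTotalDomSet.extend {D : Set V} (hD : IsTotalDomSet G D) :
    IsTotalDomSet (dartSubdiv G) (extend G D) := by
  refine isTotalDomSet_ofParts_iff.2 ⟨fun v => ?_, fun d => Classical.em _, fun d => Classical.em _⟩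
  obtain ⟨u, hu, h⟩ := hD v
  exact ⟨⟨(v, u), h⟩, hu, rfl⟩

theorem HasP3.extend {D : Set V} (hD : HasP3 G D) : HasP3 (dartSubdiv G) (extend G D) := by
  obtain ⟨a, b, c, ha, hb, hc, hab, hbc, hac, h₁, h₂⟩ := hD
  refine ⟨.inr (⟨(b, a), h₁.symm⟩, false), .inl b, .inr (⟨(b, c), h₂⟩, false), ha, hb, hc,
    by simp, by simp, by simpa using hac, ⟨rfl, rfl⟩, ⟨rfl, rfl⟩⟩

theorem ncard_symm_preimage (B : Set G.Dart) :
    {d : G.Dart | d.symm ∈ B}.ncard = B.ncard :=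
  Set.ncard_preimage_of_injective_subset_range SimpleGraph.Dart.symm_involutive.injective
    (by simp [SimpleGraph.Dart.symm_involutive.surjective.range_eq])

theorem card_dart [Finite V] : Nat.card G.Dart = 2 * G.edgeSet.ncard := by
  classical
  have : Fintype V := Fintype.ofFinite V
  rw [Nat.card_eq_fintype_card, G.dart_card_eq_twice_card_edges, Set.ncard_eq_toFinset_card',
    SimpleGraph.edgeFinset]

theorem ncard_add_ncard_of_mem_or [Finite V] {A B : Set G.Dart}
    (h : ∀ d : G.Dart, d ∈ A ∨ d.symm ∈ B) :
    A.ncard + B.ncard = 2 * G.edgeSet.ncard + {d | d ∈ A ∧ d.symm ∈ B}.ncard := by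
  classical
  have : Fintype V := Fintype.ofFinite V
  rw [← ncard_symm_preimage B, ← card_dart, ← Set.ncard_univ, ← Set.ncard_union_add_ncard_inter]
  congr 2
  exact Set.eq_univ_of_forall h

theorem ncard_extend [Finite V] (D : Set V) :
    (extend G D).ncard = D.ncard + 2 * G.edgeSet.ncard := by
  have h := ncard_add_ncard_of_mem_or (A := {d : G.Dart | d.snd ∈ D}) (B := {d | d.fst ∉ D})
    fun d => Classical.em _
  have h0 : {d : G.Dart | d ∈ {d : G.Dart | d.snd ∈ D} ∧ d.symm ∈ {d : G.Dart | d.fst ∉ D}} = ∅ :=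
    Set.eq_empty_of_forall_notMem fun d hd => hd.2 hd.1
  rw [h0, Set.ncard_empty] at h
  rw [extend, ncard_ofParts, add_assoc, h, add_zero]

/-- The total dominating set of `G` extracted from `ofParts X A B`. -/
def core (X : Set V) (A : Set G.Dart) : Set V :=
  X ∪ {v | ∃ d ∈ A, d.snd = v}

theorem snd_mem_core {X : Set V} {A : Set G.Dart} {d : G.Dart} (hd : d ∈ A) :
    d.snd ∈ core X A :=
  .inr ⟨d, hd, rfl⟩

namespace IsTotalDomParts

variable {X : Set V} {A B : Set G.Dart} (h : IsTotalDomParts X A B)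

include h

theorem isTotalDomSet_core : IsTotalDomSet G (core X A) := by
  intro v
  obtain ⟨d, hd, rfl⟩ := h.exists_mem v
  exact ⟨d.snd, snd_mem_core hd, d.adj⟩

theorem symm_mem {d : G.Dart} (hd : d.snd ∉ X) : d.symm ∈ B :=
  (h.fst_mem_or d.symm).resolve_left hd

theorem core_eq : core X A = X ∪ (·.snd) '' {d | d ∈ A ∧ d.symm ∈ B} := by
  ext v
  constructor
  · rintro (hv | ⟨d, hd, rfl⟩)
    · exact .inl hv
    · by_cases hX : d.snd ∈ X
      · exact .inl hX
      · exact .inr ⟨d, ⟨hd, h.symm_mem hX⟩, rfl⟩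
  · rintro (hv | ⟨d, hd, rfl⟩)
    · exact .inl hv
    · exact snd_mem_core hd.1

theorem ncard_core_le [Finite V] :
    (core X A).ncard + 2 * G.edgeSet.ncard ≤ (ofParts X A B).ncard := by
  classical
  have : Fintype V := Fintype.ofFinite V
  rw [ncard_ofParts, add_assoc, ncard_add_ncard_of_mem_or h.mem_or, h.core_eq]
  have h₁ := Set.ncard_union_le X ((·.snd) '' {d : G.Dart | d ∈ A ∧ d.symm ∈ B})
  have h₂ := Set.ncard_image_le (f := fun d : G.Dart => d.snd)
    (Set.toFinite {d : G.Dart | d ∈ A ∧ d.symm ∈ B})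
  omega

section Tight

variable [Finite V] (ht : (ofParts X A B).ncard ≤ (core X A).ncard + 2 * G.edgeSet.ncard)

include ht

theorem tight : Disjoint X ((·.snd) '' {d : G.Dart | d ∈ A ∧ d.symm ∈ B}) ∧
    Set.InjOn (fun d : G.Dart => d.snd) {d | d ∈ A ∧ d.symm ∈ B} := by
  classical
  have : Fintype V := Fintype.ofFinite V
  rw [ncard_ofParts, add_assoc, ncard_add_ncard_of_mem_or h.mem_or, h.core_eq] at ht
  have h₁ := Set.ncard_union_add_ncard_inter X ((·.snd) '' {d : G.Dart | d ∈ A ∧ d.symm ∈ B})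
  have h₂ := Set.ncard_image_le (f := fun d : G.Dart => d.snd)
    (Set.toFinite {d : G.Dart | d ∈ A ∧ d.symm ∈ B})
  refine ⟨?_, Set.injOn_of_ncard_image_eq (by omega)⟩
  rw [Set.disjoint_iff_inter_eq_empty, ← Set.ncard_eq_zero]
  omega

theorem snd_notMem {d : G.Dart} (hA : d ∈ A) (hB : d.symm ∈ B) : d.snd ∉ X :=
  fun hX => Set.disjoint_left.1 (h.tight ht).1 hX ⟨d, ⟨hA, hB⟩, rfl⟩

theorem eq_of_snd_eq {d d' : G.Dart} (hA : d ∈ A) (hX : d.snd ∉ X) (hA' : d' ∈ A)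
    (he : d'.snd = d.snd) : d' = d :=
  (h.tight ht).2 ⟨hA', h.symm_mem (he ▸ hX)⟩ ⟨hA, h.symm_mem hX⟩ he

theorem exists_of_all_mem {d f : G.Dart} (hA : d ∈ A) (hB : d ∈ B) (hA' : d.symm ∈ A)
    (hB' : d.symm ∈ B) (hf : f.fst = d.fst) (hne : f ≠ d) :
    ∃ D, IsTotalDomSet G D ∧ D.ncard ≤ (core X A).ncard ∧ HasP3 G D := by
  have hv : d.snd ∉ X := h.snd_notMem ht hA hB'
  have hu : d.fst ∉ X := h.snd_notMem ht hA' (by simpa using hB)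
  have hfA : f.symm ∉ A := fun hfA => hne <| by
    simpa using congrArg SimpleGraph.Dart.symm (h.eq_of_snd_eq ht hA' hu hfA hf)
  have hw : f.snd ≠ d.snd := fun he => hne (SimpleGraph.Dart.ext _ _ (Prod.ext hf he))
  obtain ⟨g, hgA, hg⟩ := h.exists_mem f.snd
  have hgv : g.snd ≠ d.snd := by
    intro he
    have hgd := h.eq_of_snd_eq ht hA hv hgA he
    exact f.adj.ne (by rw [hf, ← hg, hgd])
  refine ⟨insert f.snd (core X A \ {d.snd}), fun y => ?_, ?_, ?_⟩
  · obtain ⟨k, hkA, rfl⟩ := h.exists_mem y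
    by_cases hk : k.snd = d.snd
    · refine ⟨f.snd, .inl rfl, ?_⟩
      rw [h.eq_of_snd_eq ht hA hv hkA hk, ← hf]
      exact f.adj
    · exact ⟨k.snd, .inr ⟨snd_mem_core hkA, hk⟩, k.adj⟩
  · have h₁ := Set.ncard_insert_le f.snd (core X A \ {d.snd})
    have h₂ := Set.ncard_sdiff_singleton_add_one (snd_mem_core (X := X) hA)
    omega
  · refine hasP3_of_darts (d := f) (d' := g) hg.symm (fun he => hfA (he ▸ hgA)) (.inr ⟨?_, ?_⟩)
      (.inl rfl) (.inr ⟨snd_mem_core hgA, hgv⟩)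
    · rw [hf]
      exact snd_mem_core (d := d.symm) hA'
    · rw [hf]
      exact d.adj.ne

theorem hasP3_core {d : G.Dart} (hA : d ∈ A) (hs : d.symm ∉ A) (hd : d.fst ∈ X ∨ d.symm ∈ B) :
    HasP3 G (core X A) := by
  obtain ⟨g, hgA, hg⟩ := h.exists_mem d.snd
  have hgs : g ≠ d.symm := fun he => hs (he ▸ hgA)
  rcases hd with hu | hB
  · exact hasP3_of_darts hg.symm hgs (.inl hu) (snd_mem_core hA) (snd_mem_core hgA)
  · have hv := h.snd_notMem ht hA hB
    have hgA' : g.symm ∉ A := fun hgA' => hgs <| by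
      simpa using congrArg SimpleGraph.Dart.symm (h.eq_of_snd_eq ht hA hv hgA' hg)
    obtain ⟨k, hkA, hk⟩ := h.exists_mem g.snd
    refine hasP3_of_darts hk.symm (fun he => hgA' (he ▸ hkA)) ?_ (snd_mem_core hgA)
      (snd_mem_core hkA)
    rw [hg]
    exact snd_mem_core hA

end Tight

end IsTotalDomParts

variable [Fintype V] (hconn : G.Connected) (hcard : 3 ≤ Fintype.card V)

include hconn hcard

theorem totalDomNum_dartSubdiv :
    totalDomNum (dartSubdiv G) = totalDomNum G + 2 * G.edgeSet.ncard := by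
  have huniv : IsTotalDomSet G Set.univ := by
    intro v
    obtain ⟨d, rfl⟩ := exists_dart_fst_eq hconn hcard v
    exact ⟨d.snd, trivial, d.adj⟩
  obtain ⟨D, hD, hDc⟩ := huniv.exists_isMin
  apply le_antisymm
  · rw [← hDc, ← ncard_extend]
    exact totalDomNum_le hD.extend
  · obtain ⟨S, hS, hSc⟩ := hD.extend.exists_isMin
    obtain ⟨X, A, B, rfl⟩ := exists_eq_ofParts S
    have h := isTotalDomSet_ofParts_iff.1 hS
    have h₁ := h.ncard_core_le
    have h₂ := totalDomNum_le h.isTotalDomSet_core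
    omega

theorem exists_isMin_hasP3_dartSubdiv_iff :
    (∃ D, IsMinTotalDomSet G D ∧ HasP3 G D) ↔
      ∃ D, IsMinTotalDomSet (dartSubdiv G) D ∧ HasP3 (dartSubdiv G) D := by
  have hnum := totalDomNum_dartSubdiv hconn hcard
  constructor
  · rintro ⟨D, ⟨hD, hDc⟩, hP⟩
    exact ⟨extend G D, ⟨hD.extend, by rw [ncard_extend, hDc, hnum]⟩, hP.extend⟩
  · rintro ⟨S, ⟨hS, hSc⟩, hP⟩
    obtain ⟨X, A, B, rfl⟩ := exists_eq_ofParts S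
    have h := isTotalDomSet_ofParts_iff.1 hS
    have hle := h.ncard_core_le
    have hge := totalDomNum_le h.isTotalDomSet_core
    have ht : (ofParts X A B).ncard ≤ (core X A).ncard + 2 * G.edgeSet.ncard := by omega
    suffices ∃ D, IsTotalDomSet G D ∧ D.ncard ≤ (core X A).ncard ∧ HasP3 G D by
      obtain ⟨D, hD, hDc, hDP⟩ := this
      exact ⟨D, hD.isMin (by omega), hDP⟩
    rcases hasP3_ofParts hP with ⟨d, hd, d', hd', hX, he, hne⟩ | ⟨d, hA, hB, hd⟩
    · exact ⟨_, h.isTotalDomSet_core, le_rfl, hasP3_of_darts (d := d.symm) he.symm (by simpa)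
        (snd_mem_core hd) (.inl hX) (snd_mem_core hd')⟩
    · by_cases hs : d.symm ∈ A
      · have hu : d.fst ∉ X := h.snd_notMem ht hs (by simpa using hB)
        have hsB := hd.resolve_left hu
        obtain ⟨f, ⟨hf, hne⟩ | ⟨hf, hne⟩⟩ := exists_dart_of_connected hconn hcard d
        · exact h.exists_of_all_mem ht hA hB hs hsB hf hne
        · exact h.exists_of_all_mem ht hs hsB (by simpa) (by simpa) hf hne
      · exact ⟨_, h.isTotalDomSet_core, le_rfl, h.hasP3_core ht hA hs hd⟩

end DartSubdiv

end TD

section FullSubdiv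

variable {V : Type*} {G : SimpleGraph V} {o : G.edgeSet → V × V}
  (ho : ∀ e : G.edgeSet, s((o e).1, (o e).2) = (e : Sym2 V))

include ho

/-- The dart of an edge given by the orientation `o`. -/
def orientDart (e : G.edgeSet) : G.Dart :=
  ⟨o e, by
    rw [← SimpleGraph.mem_edgeSet, ho e]
    exact e.2⟩

theorem orientDart_edge (e : G.edgeSet) : (orientDart ho e).edge = e :=
  ho e

theorem orientDart_injective : Function.Injective (orientDart ho) := fun e e' h => by
  rw [Subtype.ext_iff, ← orientDart_edge ho e, h, orientDart_edge]

theorem orientDart_ne_symm (e e' : G.edgeSet) : orientDart ho e ≠ (orientDart ho e').symm := by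
  intro h
  have he : e = e' := by
    rw [Subtype.ext_iff, ← orientDart_edge ho e, h, SimpleGraph.Dart.edge_symm, orientDart_edge]
  subst he
  exact SimpleGraph.Dart.symm_ne _ h.symm

/-- The subdivision vertices of an edge, indexed by its two darts. -/
def subdivDart : G.edgeSet × Fin 4 → G.Dart × Bool
  | (e, 0) => (orientDart ho e, false)
  | (e, 1) => (orientDart ho e, true)
  | (e, 2) => ((orientDart ho e).symm, true)
  | (e, 3) => ((orientDart ho e).symm, false)

theorem subdivDart_bijective : Function.Bijective (subdivDart ho) := by
  have hinj := orientDart_injective ho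
  have hne := orientDart_ne_symm ho
  constructor
  · rintro ⟨e, i⟩ ⟨e', j⟩ h
    fin_cases i <;> fin_cases j <;>
      simp [subdivDart, hne, fun a b => (hne a b).symm,
        SimpleGraph.Dart.symm_involutive.injective.eq_iff, hinj.eq_iff] at h ⊢ <;> exact h
  · rintro ⟨d, b⟩
    have hd : (orientDart ho ⟨d.edge, d.edge_mem⟩).edge = d.edge := orientDart_edge ho _
    rcases (SimpleGraph.dart_edge_eq_iff _ _).1 hd with h | h <;> cases b
    · exact ⟨(⟨d.edge, d.edge_mem⟩, 0), by simp [subdivDart, h]⟩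
    · exact ⟨(⟨d.edge, d.edge_mem⟩, 1), by simp [subdivDart, h]⟩
    · exact ⟨(⟨d.edge, d.edge_mem⟩, 3), by simp [subdivDart, h]⟩
    · exact ⟨(⟨d.edge, d.edge_mem⟩, 2), by simp [subdivDart, h]⟩

theorem fullSubdivAdj_iff (a b : V ⊕ (G.edgeSet × Fin 4)) :
    (dartSubdiv G).Adj (Sum.map id (subdivDart ho) a) (Sum.map id (subdivDart ho) b) ↔
      fullSubdivAdj G o a b := by
  have hinj := orientDart_injective ho
  have hne := orientDart_ne_symm ho
  have hfst (e) : (orientDart ho e).fst = (o e).1 := rfl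
  have hsnd (e) : (orientDart ho e).snd = (o e).2 := rfl
  rcases a with a | ⟨e, i⟩ <;> rcases b with b | ⟨e', j⟩
  · exact Iff.rfl
  · fin_cases j <;> simp [dartSubdiv, fullSubdivAdj, subdivDart, hfst, hsnd]
  · fin_cases i <;> simp [dartSubdiv, fullSubdivAdj, subdivDart, hfst, hsnd]
  · fin_cases i <;> fin_cases j <;>
      simp [dartSubdiv, fullSubdivAdj, subdivDart, hne, fun a b => (hne a b).symm,
        SimpleGraph.Dart.symm_involutive.injective.eq_iff, hinj.eq_iff, eq_comm]

/-- The 4-subdivision defined by an orientation is isomorphic to `dartSubdiv G`. -/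
noncomputable def fullSubdivIso {G' : SimpleGraph (V ⊕ (↥G.edgeSet × Fin 4))}
    (hadj : ∀ a b, G'.Adj a b ↔ fullSubdivAdj G o a b) : G' ≃g dartSubdiv G where
  toEquiv := Equiv.sumCongr (Equiv.refl V) (Equiv.ofBijective _ (subdivDart_bijective ho))
  map_rel_iff' {a b} := (fullSubdivAdj_iff ho a b).trans (hadj a b).symm

end FullSubdiv

theorem stmt5 {V : Type*} [Fintype V] (G : SimpleGraph V) [Fintype ↥G.edgeSet]
    (hconn : G.Connected) (hcard : 3 ≤ Fintype.card V)
    (o : G.edgeSet → V × V) (ho : ∀ e : G.edgeSet, s((o e).1, (o e).2) = (e : Sym2 V))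
    (G' : SimpleGraph (V ⊕ (↥G.edgeSet × Fin 4)))
    (hadj : ∀ a b, G'.Adj a b ↔ fullSubdivAdj G o a b) :
    totalDomNum G' = totalDomNum G + 2 * G.edgeSet.ncard ∧
      ((∃ D, IsMinTotalDomSet G D ∧ HasP3 G D) ↔
        (∃ D, IsMinTotalDomSet G' D ∧ HasP3 G' D)) := by
  let φ := fullSubdivIso ho hadj
  refine ⟨(totalDomNum_congr φ).trans (totalDomNum_dartSubdiv hconn hcard), ?_⟩
  rw [exists_isMin_hasP3_dartSubdiv_iff hconn hcard]
  exact ⟨exists_isMin_hasP3_of_iso φ.symm, exists_isMin_hasP3_of_iso φ⟩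
end

section
/- Every connected P5-free graph G with γ_t(G) ≥ 3 has a minimum total dominating set that contains a P3. -/
open SimpleGraph

open TD SimpleGraph

namespace TD

variable {V : Type*} {G : SimpleGraph V} {D : Set V}

theorem IndFree.not_inducedPath_five (hfree : IndFree G (pathGraph 5)) {a b c d e : V}
    (hab : G.Adj a b) (hbc : G.Adj b c) (hcd : G.Adj c d) (hde : G.Adj d e)
    (hac : ¬ G.Adj a c) (had : ¬ G.Adj a d) (hae : ¬ G.Adj a e)
    (hbd : ¬ G.Adj b d) (hbe : ¬ G.Adj b e) (hce : ¬ G.Adj c e) : False := by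
  have hadj : ∀ i j : Fin 5,
      G.Adj (![a, b, c, d, e] i) (![a, b, c, d, e] j) ↔ (pathGraph 5).Adj i j := by
    intro i j
    rw [pathGraph_adj]
    fin_cases i <;> fin_cases j <;> simp [*, G.adj_comm]
  have hinj : Function.Injective ![a, b, c, d, e] := by
    intro i j hij
    have h : ∀ k, (pathGraph 5).Adj i k ↔ (pathGraph 5).Adj j k := fun k => by
      rw [← hadj, ← hadj, hij]
    simp only [pathGraph_adj] at h
    clear hij
    revert i j
    decide
  exact hfree ⟨⟨⟨_, hinj⟩, hadj _ _⟩⟩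

theorem exists_isMinTotalDomSet (h : 0 < totalDomNum G) : ∃ D, IsMinTotalDomSet G D := by
  apply Nat.sInf_mem (s := {m | ∃ D : Set V, IsTotalDomSet G D ∧ D.ncard = m})
  exact Nat.nonempty_of_pos_sInf h

/-- In a set without a `P3`, a vertex has at most one neighbor. -/
theorem eq_of_not_hasP3 (hD : ¬ HasP3 G D) {a b c : V} (ha : a ∈ D) (hb : b ∈ D) (hc : c ∈ D)
    (hab : G.Adj a b) (hbc : G.Adj b c) : a = c := by
  by_contra hac
  exact hD ⟨a, b, c, ha, hb, hc, hab.ne, hbc.ne, hac, hab, hbc⟩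

/-- If exchanging `p` for `v` creates a `P3` centered at `v`, then, unless this yields a minimum
total dominating set containing a `P3`, `p` has a private neighbor not adjacent to `v`. -/
theorem exists_private_not_adj [Finite V] (hno : ∀ D, IsMinTotalDomSet G D → ¬ HasP3 G D)
    (hmin : IsMinTotalDomSet G D) {p q r v : V} (hp : p ∈ D) (hq : q ∈ D) (hr : r ∈ D)
    (hqp : q ≠ p) (hrp : r ≠ p) (hqr : q ≠ r) (hvq : G.Adj v q) (hvr : G.Adj v r) :
    ∃ w, G.Adj w p ∧ (∀ u ∈ D, u ≠ p → ¬ G.Adj w u) ∧ ¬ G.Adj w v := by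
  have hv : v ∉ D := fun hv => hqr (eq_of_not_hasP3 (hno D hmin) hq hv hr hvq.symm hvr)
  by_contra! hw
  refine hno (insert v (D \ {p})) ⟨fun w => ?_, ?_⟩
    ⟨q, v, r, by simp [hq, hqp], by simp, by simp [hr, hrp], hvq.ne', hvr.ne, hqr, hvq.symm, hvr⟩
  · obtain ⟨u, hu, hwu⟩ := hmin.1 w
    by_cases hex : ∃ u ∈ D, u ≠ p ∧ G.Adj w u
    · obtain ⟨u, hu, hup, hwu⟩ := hex
      exact ⟨u, by simp [hu, hup], hwu⟩
    · push Not at hex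
      have hup : u = p := by
        by_contra hup
        exact hex u hu hup hwu
      exact ⟨v, by simp, hw w (hup ▸ hwu) hex⟩
  · rw [Set.ncard_exchange hv hp, hmin.2]

/-- If every minimum total dominating set is `P3`-free, no vertex has neighbors in two different
edges `xy` and `zt` of such a set. -/
theorem not_adj_of_adj [Finite V] (hfree : IndFree G (pathGraph 5))
    (hno : ∀ D, IsMinTotalDomSet G D → ¬ HasP3 G D) (hmin : IsMinTotalDomSet G D)
    {x y z t v : V} (hx : x ∈ D) (hy : y ∈ D) (hz : z ∈ D) (ht : t ∈ D)
    (hxy : G.Adj x y) (hzt : G.Adj z t) (hxz : x ≠ z) (hyz : y ≠ z)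
    (hvx : G.Adj v x) : ¬ G.Adj v z := by
  intro hvz
  have huniq := @eq_of_not_hasP3 V G D (hno D hmin)
  have hxz' : ¬ G.Adj x z := fun h => hyz (huniq hy hx hz hxy.symm h)
  have hyz' : ¬ G.Adj y z := fun h => hxz (huniq hx hy hz hxy h)
  have hxt : ¬ G.Adj x t := fun h => hxz (huniq hx ht hz h hzt.symm)
  have hyt : ¬ G.Adj y t := fun h => hyz (huniq hy ht hz h hzt.symm)
  have hxt' : x ≠ t := fun h => hxz' (h ▸ hzt.symm)
  have hyt' : y ≠ t := fun h => hyz' (h ▸ hzt.symm)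
  have hall : G.Adj v y ∧ G.Adj v t := by
    by_cases hvy : G.Adj v y
    · refine ⟨hvy, ?_⟩
      by_contra hvt
      obtain ⟨w, hwx, hw, hwv⟩ :=
        exists_private_not_adj hno hmin hx hy hz hxy.ne' hxz.symm hyz hvy hvz
      exact hfree.not_inducedPath_five hwx hvx.symm hvz hzt hwv (hw z hz hxz.symm)
        (hw t ht hxt'.symm) hxz' hxt hvt
    · by_cases hvt : G.Adj v t
      · obtain ⟨w, hwz, hw, hwv⟩ :=
          exists_private_not_adj hno hmin hz ht hx hzt.ne' hxz hxt'.symm hvt hvx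
        exact (hfree.not_inducedPath_five hwz hvz.symm hvx hxy hwv (hw x hx hxz)
          (hw y hy hyz) (fun h => hxz' h.symm) (fun h => hyz' h.symm) hvy).elim
      · exact (hfree.not_inducedPath_five hxy.symm hvx.symm hvz hzt (fun h => hvy h.symm)
          hyz' hyt hxz' hxt hvt).elim
  obtain ⟨w, hwx, hw, hwv⟩ :=
    exists_private_not_adj hno hmin hx hy hz hxy.ne' hxz.symm hyz hall.1 hvz
  obtain ⟨s, hsz, hs, hsv⟩ :=
    exists_private_not_adj hno hmin hz ht hx hzt.ne' hxz hxt'.symm hall.2 hvx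
  have hws : G.Adj w s := by
    by_contra hws
    exact hfree.not_inducedPath_five hwx hvx.symm hvz hsz.symm hwv (hw z hz hxz.symm) hws hxz'
      (fun h => hs x hx hxz h.symm) (fun h => hsv h.symm)
  exact hfree.not_inducedPath_five hxy.symm hwx.symm hws hsz (fun h => hw y hy hxy.ne' h.symm)
    (fun h => hs y hy hyz h.symm) hyz' (fun h => hs x hx hxz h.symm) hxz' (hw z hz hxz.symm)

/-- If every minimum total dominating set is `P3`-free, no edge `ab` links the neighborhoods of two
different edges `xy` and `zt` of such a set. -/
theorem not_adj_of_adj_of_adj [Finite V] (hfree : IndFree G (pathGraph 5))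
    (hno : ∀ D, IsMinTotalDomSet G D → ¬ HasP3 G D) (hmin : IsMinTotalDomSet G D)
    {x y z t a b : V} (hx : x ∈ D) (hy : y ∈ D) (hz : z ∈ D) (ht : t ∈ D)
    (hxy : G.Adj x y) (hzt : G.Adj z t) (hxz : x ≠ z) (hyz : y ≠ z)
    (hax : G.Adj a x) (hbz : G.Adj b z) : ¬ G.Adj a b := by
  intro hab
  have huniq := @eq_of_not_hasP3 V G D (hno D hmin)
  have hfar : ∀ {p q r s v : V}, p ∈ D → q ∈ D → r ∈ D → s ∈ D → G.Adj p q → G.Adj r s →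
      p ≠ r → q ≠ r → G.Adj v p → ¬ G.Adj v r := not_adj_of_adj hfree hno hmin
  have hxz' : ¬ G.Adj x z := fun h => hyz (huniq hy hx hz hxy.symm h)
  have hyz' : ¬ G.Adj y z := fun h => hxz (huniq hx hy hz hxy h)
  have hxt : x ≠ t := fun h => hxz' (h ▸ hzt.symm)
  have hyt : y ≠ t := fun h => hyz' (h ▸ hzt.symm)
  have hxt' : ¬ G.Adj x t := fun h => hxz (huniq hx ht hz h hzt.symm)
  have haz : ¬ G.Adj a z := hfar hx hy hz ht hxy hzt hxz hyz hax
  have hat : ¬ G.Adj a t := hfar hx hy ht hz hxy hzt.symm hxt hyt hax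
  have hbx : ¬ G.Adj b x := hfar hz ht hx hy hzt hxy hxz.symm hxt.symm hbz
  have hby : ¬ G.Adj b y := hfar hz ht hy hx hzt hxy.symm hyz.symm hyt.symm hbz
  have hay : G.Adj a y := by
    by_contra hay
    exact hfree.not_inducedPath_five hxy.symm hax.symm hab hbz (fun h => hay h.symm)
      (fun h => hby h.symm) hyz' (fun h => hbx h.symm) hxz' haz
  have hbt : G.Adj b t := by
    by_contra hbt
    exact hfree.not_inducedPath_five hzt.symm hbz.symm hab.symm hax (fun h => hbt h.symm)
      (fun h => hat h.symm) (fun h => hxt' h.symm) (fun h => haz h.symm)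
      (fun h => hxz' h.symm) hbx
  have haD : a ∉ D := fun haD => hxy.ne (huniq hx haD hy hax.symm hay)
  have hbD : b ∉ D := fun hbD => hzt.ne (huniq hz hbD ht hbz.symm hbt)
  refine hno (insert b (insert a (D \ {x}) \ {z})) ⟨fun w => ?_, ?_⟩
    ⟨y, a, b, ?_, ?_, by simp, hay.ne', hab.ne, ?_, hay.symm, hab⟩
  · by_cases hwa : G.Adj w a
    · exact ⟨a, by simp; grind, hwa⟩
    by_cases hwb : G.Adj w b
    · exact ⟨b, by simp, hwb⟩
    obtain ⟨u, hu, hwu⟩ := hmin.1 w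
    by_cases hux : u = x
    · subst hux
      exact (hfree.not_inducedPath_five hwu hax.symm hab hbz hwa hwb
        (hfar hx hy hz ht hxy hzt hxz hyz hwu) (fun h => hbx h.symm) hxz' haz).elim
    by_cases huz : u = z
    · subst huz
      exact (hfree.not_inducedPath_five hwu hbz.symm hab.symm hax hwb hwa
        (hfar hz ht hx hy hzt hxy hxz.symm hxt.symm hwu) (fun h => haz h.symm)
        (fun h => hxz' h.symm) hbx).elim
    exact ⟨u, by simp [hu, hux, huz], hwu⟩
  · rw [Set.ncard_exchange, Set.ncard_exchange haD hx, hmin.2]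
    · simp [hbD, hab.ne']
    · simp [hz, hxz.symm]
  · simp [hy, hxy.ne', hyz]
  · simp; grind
  · grind

end TD

theorem stmt6 {V : Type*} [Fintype V] (G : SimpleGraph V) (hconn : G.Connected)
    (hfree : IndFree G (pathGraph 5)) (h3 : 3 ≤ totalDomNum G) :
    ∃ D, IsMinTotalDomSet G D ∧ HasP3 G D := by
  by_contra! hno
  obtain ⟨D, hmin⟩ := exists_isMinTotalDomSet (G := G) (by omega)
  obtain ⟨v⟩ := hconn.nonempty
  obtain ⟨x, hx, -⟩ := hmin.1 v
  obtain ⟨y, hy, hxy⟩ := hmin.1 x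
  obtain ⟨z, hz, hzxy⟩ : ∃ z ∈ D, z ∉ ({x, y} : Set V) := by
    apply Set.exists_mem_notMem_of_ncard_lt_ncard
    · rw [Set.ncard_pair hxy.ne, hmin.2]
      omega
    · exact Set.toFinite _
  simp only [Set.mem_insert_iff, Set.mem_singleton_iff, not_or] at hzxy
  obtain ⟨t, ht, hzt⟩ := hmin.1 z
  have hfar : ∀ {p q r v : V}, p ∈ D → q ∈ D → r ∈ D → G.Adj p q →
      p ≠ r → q ≠ r → G.Adj v p → ¬ G.Adj v r := fun hp hq hr hpq hpr hqr =>
    let ⟨_, hs, hrs⟩ := hmin.1 _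
    not_adj_of_adj hfree hno hmin hp hq hr hs hpq hrs hpr hqr
  obtain ⟨p⟩ := hconn.preconnected y t
  obtain ⟨d, -, hd, hd'⟩ := p.exists_boundary_dart {w | G.Adj w x ∨ G.Adj w y} (Or.inl hxy.symm)
    (by
      rintro (h | h)
      · exact hfar hx hy hz hxy (Ne.symm hzxy.1) (Ne.symm hzxy.2) h hzt.symm
      · exact hfar hy hx hz hxy.symm (Ne.symm hzxy.2) (Ne.symm hzxy.1) h hzt.symm)
  simp only [Set.mem_ofPred_eq, not_or] at hd hd'
  obtain ⟨r, hr, hdr⟩ := hmin.1 d.snd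
  obtain ⟨s, hs, hrs⟩ := hmin.1 r
  have hxr : x ≠ r := fun h => hd'.1 (h ▸ hdr)
  have hyr : y ≠ r := fun h => hd'.2 (h ▸ hdr)
  rcases hd with h | h
  · exact not_adj_of_adj_of_adj hfree hno hmin hx hy hr hs hxy hrs hxr hyr h hdr d.adj
  · exact not_adj_of_adj_of_adj hfree hno hmin hy hx hr hs hxy.symm hrs hyr hxr h hdr d.adj
end

section
/- Fix an integer k ≥ 1. Let G be a (P4+kP3)-free graph and let A ⊆ V(G) be such that G[A] is isomorphic to P4+(k−1)P3. Let C be the set of vertices of G at distance at least two from A. Then the induced subgraph G[C] contains no induced P3; equivalently, G[C] is a disjoint union of cliques. -/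
open SimpleGraph

open TD SimpleGraph


@[simp]
theorem TD.p4kp3_adj_inl_inl {k : ℕ} {x y : Fin 4} :
    (p4kp3 k).Adj (Sum.inl x) (Sum.inl y) ↔ (pathGraph 4).Adj x y := by
  simp [p4kp3]

@[simp]
theorem TD.p4kp3_adj_inr_inr {k : ℕ} {p q : Fin k × Fin 3} :
    (p4kp3 k).Adj (Sum.inr p) (Sum.inr q) ↔ p.1 = q.1 ∧ (pathGraph 3).Adj p.2 q.2 := by
  simp [p4kp3, kCopies]

@[simp]
theorem TD.not_p4kp3_adj_inl_inr {k : ℕ} {x : Fin 4} {p : Fin k × Fin 3} :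
    ¬ (p4kp3 k).Adj (Sum.inl x) (Sum.inr p) := by
  simp [p4kp3]

@[simp]
theorem TD.not_p4kp3_adj_inr_inl {k : ℕ} {p : Fin k × Fin 3} {x : Fin 4} :
    ¬ (p4kp3 k).Adj (Sum.inr p) (Sum.inl x) := by
  simp [p4kp3]

/-- A disjoint copy of `P3` with no edges to an induced `P4 + m·P3` extends it to an induced
`P4 + (m + 1)·P3`. -/
theorem TD.nonempty_p4kp3_succ_embedding {V : Type*} {G : SimpleGraph V} {m : ℕ}
    (f : p4kp3 m ↪g G) (h : pathGraph 3 ↪g G) (hne : ∀ x y, f x ≠ h y)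
    (hadj : ∀ x y, ¬ G.Adj (f x) (h y)) : Nonempty (p4kp3 (m + 1) ↪g G) := by
  let g : Fin 4 ⊕ (Fin (m + 1) × Fin 3) → V :=
    Sum.elim (fun x => f (Sum.inl x))
      (fun p => Fin.lastCases (motive := fun _ => V) (h p.2) (fun i => f (Sum.inr (i, p.2))) p.1)
  have g_inl (x) : g (Sum.inl x) = f (Sum.inl x) := rfl
  have g_last (y) : g (Sum.inr (Fin.last m, y)) = h y := by simp [g]
  have g_castSucc (i : Fin m) (y) : g (Sum.inr (i.castSucc, y)) = f (Sum.inr (i, y)) := by simp [g]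
  have hne' (x y) : h y ≠ f x := (hne x y).symm
  have hadj' (x y) : ¬ G.Adj (h y) (f x) := fun h' => hadj x y h'.symm
  have hlast (i : Fin m) : Fin.last m ≠ i.castSucc := (Fin.castSucc_ne_last i).symm
  refine ⟨⟨⟨g, ?_⟩, ?_⟩⟩
  · rintro (x | ⟨i, x⟩) (y | ⟨j, y⟩)
    · simp [g_inl]
    · cases j using Fin.lastCases <;> simp [g_inl, g_last, g_castSucc, hne]
    · cases i using Fin.lastCases <;> simp [g_inl, g_last, g_castSucc, hne']
    · cases i using Fin.lastCases <;> cases j using Fin.lastCases <;>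
        simp [g_last, g_castSucc, hne, hne']
  · intro u v
    change G.Adj (g u) (g v) ↔ _
    rcases u with x | ⟨i, x⟩ <;> rcases v with y | ⟨j, y⟩
    · simp [g_inl]
    · cases j using Fin.lastCases <;> simp [g_inl, g_last, g_castSucc, hadj]
    · cases i using Fin.lastCases <;> simp [g_inl, g_last, g_castSucc, hadj']
    · cases i using Fin.lastCases <;> cases j using Fin.lastCases <;>
        simp [g_last, g_castSucc, hadj, hadj', hlast]

/-- Two nonadjacent distinct vertices with a common neighbor form an induced `P3`. -/
theorem TD.exists_pathGraph_three_embedding {V : Type*} {G : SimpleGraph V} {a b c : V}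
    (hab : G.Adj a b) (hbc : G.Adj b c) (hac : a ≠ c) (hnac : ¬ G.Adj a c) :
    ∃ h : pathGraph 3 ↪g G, ∀ y, h y = a ∨ h y = b ∨ h y = c := by
  have hnca : ¬ G.Adj c a := fun h => hnac h.symm
  refine ⟨⟨⟨![a, b, c], ?_⟩, ?_⟩, ?_⟩
  · intro x y
    fin_cases x <;> fin_cases y <;>
      simp [hab.ne, hab.ne', hbc.ne, hbc.ne', hac, hac.symm]
  · intro x y
    change G.Adj (![a, b, c] x) (![a, b, c] y) ↔ _
    fin_cases x <;> fin_cases y <;>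
      simp [pathGraph_adj, hab, hab.symm, hbc, hbc.symm, hnac, hnca]
  · intro y
    change ![a, b, c] y = a ∨ ![a, b, c] y = b ∨ ![a, b, c] y = c
    fin_cases y <;> simp

theorem stmt7 {V : Type*} [Fintype V] (k : ℕ) (hk : 1 ≤ k) (G : SimpleGraph V)
    (hfree : IndFree G (p4kp3 k))
    (A : Set V) (hA : Nonempty (G.induce A ≃g p4kp3 (k - 1)))
    (C : Set V) (hC : C = {v | v ∉ A ∧ ∀ a ∈ A, ¬ G.Adj v a}) :
    ∀ a b c : V, a ∈ C → b ∈ C → c ∈ C → G.Adj a b → G.Adj b c → a ≠ c → G.Adj a c := by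
  obtain ⟨m, rfl⟩ : ∃ m, k = m + 1 := ⟨k - 1, by omega⟩
  obtain ⟨e⟩ := hA
  intro a b c ha hb hc hab hbc hac
  by_contra hnac
  obtain ⟨h, hh⟩ := exists_pathGraph_three_embedding hab hbc hac hnac
  let f : p4kp3 m ↪g G := (Embedding.induce A).comp e.symm.toEmbedding
  have hfA (x) : f x ∈ A := (e.symm x).2
  have hhC (y) : h y ∉ A ∧ ∀ a ∈ A, ¬ G.Adj (h y) a := by
    subst hC
    rcases hh y with hy | hy | hy <;> rw [hy] <;> assumption
  exact hfree (nonempty_p4kp3_succ_embedding f h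
    (fun x y hxy => (hhC y).1 (hxy ▸ hfA x))
    (fun x y hxy => (hhC y).2 _ (hfA x) hxy.symm))
end

section
/- Let G be a graph and let K ⊆ V(G) be a clique with |K| ≥ 2 such that the induced subgraph G[N[K]] contains no induced P4. Then there exist distinct vertices x, y ∈ K such that N[{x,y}] = N[K] and, for every vertex v ∈ N[K], either N[K] ⊆ N[{v,x}] or N[K] ⊆ N[{v,y}]. -/
open SimpleGraph

open TD SimpleGraph


namespace TD

theorem mem_closedNbhd_pair {V : Type*} {G : SimpleGraph V} {a b w : V} :
    w ∈ closedNbhd G {a, b} ↔ (w = a ∨ w = b) ∨ G.Adj a w ∨ G.Adj b w := by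
  simp [closedNbhd, nbhd]

/-- A graph induced on `S` without induced `P4` contains no induced path `a - b - c - d`. -/
theorem IndFree.not_path {V : Type*} {G : SimpleGraph V} {S : Set V}
    (h : IndFree (G.induce S) (pathGraph 4)) {a b c d : V}
    (ha : a ∈ S) (hb : b ∈ S) (hc : c ∈ S) (hd : d ∈ S)
    (hab : G.Adj a b) (hbc : G.Adj b c) (hcd : G.Adj c d)
    (hac : ¬ G.Adj a c) (hbd : ¬ G.Adj b d) (had : ¬ G.Adj a d) : False := by
  have hadj : ∀ i j : Fin 4, (G.induce S).Adj
      ((![⟨a, ha⟩, ⟨b, hb⟩, ⟨c, hc⟩, ⟨d, hd⟩] : Fin 4 → S) i)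
      ((![⟨a, ha⟩, ⟨b, hb⟩, ⟨c, hc⟩, ⟨d, hd⟩] : Fin 4 → S) j) ↔ (pathGraph 4).Adj i j := by
    intro i j
    fin_cases i <;> fin_cases j <;>
      simp [pathGraph_adj, hab, hbc, hcd, hac, hbd, had, hab.symm, hbc.symm, hcd.symm,
        G.adj_comm c a, G.adj_comm d b, G.adj_comm d a]
  have h1 : a ≠ b := hab.ne
  have h2 : b ≠ c := hbc.ne
  have h3 : c ≠ d := hcd.ne
  have h4 : a ≠ c := by rintro rfl; exact had hcd
  have h5 : b ≠ d := by rintro rfl; exact had hab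
  have h6 : a ≠ d := by rintro rfl; exact hac hcd.symm
  have hinj : Function.Injective
      (![⟨a, ha⟩, ⟨b, hb⟩, ⟨c, hc⟩, ⟨d, hd⟩] : Fin 4 → S) := by
    intro i j hij
    fin_cases i <;> fin_cases j <;>
      simp [h1, h2, h3, h4, h5, h6, h1.symm, h2.symm, h3.symm, h4.symm, h5.symm, h6.symm] at hij ⊢
  exact h ⟨⟨⟨_, hinj⟩, hadj _ _⟩⟩

/-- In a clique whose closed neighborhood is `P4`-free, each vertex of the clique
together with some other one dominates this neighborhood. -/
theorem exists_dominating_pair {V : Type*} [Finite V] {G : SimpleGraph V} {K : Set V}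
    (hK : G.IsClique K) (hcard : 2 ≤ K.ncard)
    (hP4 : IndFree (G.induce (closedNbhd G K)) (pathGraph 4)) {x : V} (hx : x ∈ K) :
    ∃ y ∈ K, x ≠ y ∧ closedNbhd G K ⊆ closedNbhd G {x, y} := by
  obtain ⟨y₀, hy₀, hxy₀⟩ := Set.exists_ne_of_one_lt_ncard (by omega : 1 < K.ncard) x
  have hKN : K ⊆ closedNbhd G K := Set.subset_union_left
  obtain ⟨y, ⟨hy, hyx⟩, hmin⟩ := Set.exists_min_image {y | y ∈ K ∧ y ≠ x}
    (fun y => (closedNbhd G K \ closedNbhd G {x, y}).ncard) (Set.toFinite _) ⟨y₀, hy₀, hxy₀⟩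
  refine ⟨y, hy, hyx.symm, fun u hu => by_contra fun hu' => ?_⟩
  have hu'' := hu'
  simp only [mem_closedNbhd_pair, not_or] at hu''
  obtain ⟨⟨hux, huy⟩, hxu, hyu⟩ := hu''
  have huK : u ∉ K := fun h => hxu (hK hx h (Ne.symm hux))
  obtain h | ⟨z, hz, hzu⟩ := hu
  · exact huK h
  have hzx : z ≠ x := by rintro rfl; exact hxu hzu
  have hzy : z ≠ y := by rintro rfl; exact hyu hzu
  have huN : u ∈ closedNbhd G K := Or.inr ⟨z, hz, hzu⟩
  obtain ⟨p, ⟨hpN, hpz⟩, hp⟩ : ∃ p ∈ closedNbhd G K \ closedNbhd G {x, z},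
      p ∉ closedNbhd G K \ closedNbhd G {x, y} := by
    by_contra! hsub
    refine (hmin z ⟨hz, hzx⟩).not_gt (Set.ncard_lt_ncard ⟨hsub, fun hsub' => ?_⟩ (Set.toFinite _))
    exact (hsub' ⟨huN, hu'⟩).2 (mem_closedNbhd_pair.2 (.inr (.inr hzu)))
  have hpy : p ∈ closedNbhd G {x, y} := by_contra fun h => hp ⟨hpN, h⟩
  simp only [mem_closedNbhd_pair, not_or] at hpz hpy
  obtain ⟨⟨hpx, -⟩, hxp, hzp⟩ := hpz
  have hyp : G.Adj y p := by
    rcases hpy with (h | rfl) | h | h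
    · exact absurd h hpx
    · exact absurd (hK hx hy hyx.symm) hxp
    · exact absurd h hxp
    · exact h
  by_cases hpu : G.Adj p u
  · exact hP4.not_path (hKN hx) (hKN hy) hpN huN (hK hx hy hyx.symm) hyp hpu hxp hyu hxu
  · exact hP4.not_path hpN (hKN hy) (hKN hz) huN hyp.symm (hK hy hz hzy.symm) hzu
      (fun h => hzp h.symm) hyu hpu

end TD

theorem stmt8 {V : Type*} [Fintype V] (G : SimpleGraph V) (K : Set V)
    (hK : G.IsClique K) (hcard : 2 ≤ K.ncard)
    (hP4 : IndFree (G.induce (closedNbhd G K)) (pathGraph 4)) :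
    ∃ x ∈ K, ∃ y ∈ K, x ≠ y ∧ closedNbhd G {x, y} = closedNbhd G K ∧
      ∀ v ∈ closedNbhd G K,
        closedNbhd G K ⊆ closedNbhd G {v, x} ∨ closedNbhd G K ⊆ closedNbhd G {v, y} := by
  obtain ⟨x, hx⟩ : K.Nonempty := Set.nonempty_of_ncard_ne_zero (by omega)
  obtain ⟨y, hy, hxy, hdom⟩ := exists_dominating_pair hK hcard hP4 hx
  have hKN : K ⊆ closedNbhd G K := Set.subset_union_left
  refine ⟨x, hx, y, hy, hxy, hdom.antisymm' ?_, fun v hv => ?_⟩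
  · intro w hw
    rcases mem_closedNbhd_pair.1 hw with (rfl | rfl) | h | h
    · exact hKN hx
    · exact hKN hy
    · exact Or.inr ⟨x, hx, h⟩
    · exact Or.inr ⟨y, hy, h⟩
  · by_contra! hcon
    obtain ⟨⟨a, haN, ha⟩, ⟨b, hbN, hb⟩⟩ := hcon.imp Set.not_subset.1 Set.not_subset.1
    have hda := mem_closedNbhd_pair.1 (hdom haN)
    have hdb := mem_closedNbhd_pair.1 (hdom hbN)
    have hdv := mem_closedNbhd_pair.1 (hdom hv)
    have hadj := hK hx hy hxy
    have hadj_symm := hadj.symm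
    clear hcon
    simp only [mem_closedNbhd_pair, not_or] at ha hb
    obtain ⟨⟨hav, hax⟩, hva, hxa⟩ := ha
    obtain ⟨⟨hbv, hby⟩, hvb, hyb⟩ := hb
    have hya : G.Adj y a := by grind
    have hxb : G.Adj x b := by grind
    have hab : G.Adj a b := by
      by_contra h
      exact hP4.not_path haN (hKN hy) (hKN hx) hbN hya.symm hadj.symm hxb
        (fun h => hxa h.symm) hyb h
    have hvx : v ≠ x := by rintro rfl; exact hvb hxb
    have hvy : v ≠ y := by rintro rfl; exact hva hya
    rcases hdv with (h | h) | h | h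
    · exact hvx h
    · exact hvy h
    · exact hP4.not_path hv (hKN hx) hbN haN h.symm hxb hab.symm hvb hxa hva
    · exact hP4.not_path hv (hKN hy) haN hbN h.symm hya hab hva hyb hvb
end

section
/- Under the (P4+kP3)-free setup, let K_1,…,K_{k+1} be regular cliques that pairwise have distance at least four from one another. For any i ∈ {1,…,k+1}, if a vertex v ∈ V(G)∖N[K_i] is adjacent to some vertex of N(K_i) ∩ B, then there exists j ∈ {1,…,k+1} with j ≠ i such that v is adjacent to every vertex of N(K_j) ∩ B. -/
open SimpleGraph

open TD SimpleGraph


namespace TD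

theorem exists_pathGraph_three_embedding_s9 {V : Type*} {G : SimpleGraph V} {a b c : V}
    (hab : G.Adj a b) (hbc : G.Adj b c) (hac : ¬ G.Adj a c) (hne : a ≠ c) :
    ∃ f : pathGraph 3 ↪g G, f 0 = a ∧ f 1 = b ∧ f 2 = c := by
  refine ⟨⟨⟨![a, b, c], ?_⟩, ?_⟩, rfl, rfl, rfl⟩
  · intro m n h
    fin_cases m <;> fin_cases n <;> simp_all [hab.ne, hbc.ne, hab.ne', hbc.ne', hne.symm]
  · intro m n
    change G.Adj (![a, b, c] m) (![a, b, c] n) ↔ _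
    fin_cases m <;> fin_cases n <;> simp_all [pathGraph_adj, G.adj_comm]

theorem exists_pathGraph_four_embedding {V : Type*} {G : SimpleGraph V} {a b c d : V}
    (hab : G.Adj a b) (hbc : G.Adj b c) (hcd : G.Adj c d)
    (hac : ¬ G.Adj a c) (had : ¬ G.Adj a d) (hbd : ¬ G.Adj b d) :
    ∃ f : pathGraph 4 ↪g G, f 0 = a ∧ f 1 = b ∧ f 2 = c ∧ f 3 = d := by
  have hac' : a ≠ c := by rintro rfl; exact had hcd
  have had' : a ≠ d := by rintro rfl; exact hbd hab.symm
  have hbd' : b ≠ d := by rintro rfl; exact had hab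
  refine ⟨⟨⟨![a, b, c, d], ?_⟩, ?_⟩, rfl, rfl, rfl, rfl⟩
  · intro m n h
    fin_cases m <;> fin_cases n <;>
      simp_all [hab.ne, hbc.ne, hcd.ne, hab.ne', hbc.ne', hcd.ne', hac'.symm, had'.symm,
        hbd'.symm]
  · intro m n
    change G.Adj (![a, b, c, d] m) (![a, b, c, d] n) ↔ _
    fin_cases m <;> fin_cases n <;> simp_all [pathGraph_adj, G.adj_comm]

/-- Pairwise disjoint and anticomplete induced copies of one `P4` and `k` copies of `P3`
assemble into an induced `P4 + k·P3`. -/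
theorem nonempty_p4kp3_embedding {V : Type*} {G : SimpleGraph V} {k : ℕ}
    (p : pathGraph 4 ↪g G) (q : Fin k → (pathGraph 3 ↪g G))
    (hpq : ∀ m j n, p m ≠ q j n ∧ ¬ G.Adj (p m) (q j n))
    (hqq : ∀ j j', j ≠ j' → ∀ m n, q j m ≠ q j' n ∧ ¬ G.Adj (q j m) (q j' n)) :
    Nonempty (p4kp3 k ↪g G) := by
  refine ⟨⟨⟨Sum.elim p fun t => q t.1 t.2, ?_⟩, ?_⟩⟩
  · rintro (m | ⟨j, m⟩) (n | ⟨j', n⟩) h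
    · exact congrArg _ (p.injective h)
    · exact absurd h (hpq m j' n).1
    · exact absurd h.symm (hpq n j m).1
    · obtain rfl : j = j' := by
        by_contra hj
        exact (hqq j j' hj m n).1 h
      obtain rfl : m = n := (q j).injective h
      rfl
  · intro s t
    change G.Adj (Sum.elim p (fun t => q t.1 t.2) s) (Sum.elim p (fun t => q t.1 t.2) t) ↔ _
    obtain m | ⟨j, m⟩ := s <;> obtain n | ⟨j', n⟩ := t
    · simp [p4kp3]
    · simpa [p4kp3] using (hpq m j' n).2
    · simpa [p4kp3, G.adj_comm] using (hpq n j m).2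
    · by_cases hj : j = j'
      · subst hj
        simp [p4kp3, kCopies]
      · simpa [p4kp3, kCopies, hj] using (hqq j j' hj m n).2

theorem le_dist_of_le_setDist {V : Type*} {G : SimpleGraph V} {S T : Set V} {n : ℕ}
    (h : n ≤ setDist G S T) {s t : V} (hs : s ∈ S) (ht : t ∈ T) : n ≤ G.dist s t :=
  h.trans (Nat.sInf_le ⟨s, hs, t, ht, rfl⟩)

theorem ne_and_not_adj_of_two_le_dist {V : Type*} {G : SimpleGraph V} {s t : V}
    (h : 2 ≤ G.dist s t) : s ≠ t ∧ ¬ G.Adj s t := by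
  refine ⟨?_, fun hadj => ?_⟩
  · rintro rfl
    simp at h
  · rw [dist_eq_one_iff_adj.mpr hadj] at h
    omega

/-- Vertices close to two sets that are far apart are themselves far apart. -/
theorem le_dist_add_of_le_setDist {V : Type*} {G : SimpleGraph V} (hconn : G.Connected)
    {S T : Set V} {n d e : ℕ} (h : n ≤ setDist G S T) {s t : V}
    (hs : ∃ u ∈ S, G.dist u s ≤ d) (ht : ∃ u ∈ T, G.dist u t ≤ e) :
    n ≤ G.dist s t + d + e := by
  obtain ⟨a, ha, has⟩ := hs
  obtain ⟨c, hc, hct⟩ := ht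
  have h₁ := le_dist_of_le_setDist h ha hc
  have h₂ := hconn.dist_triangle (u := a) (v := s) (w := c)
  have h₃ := hconn.dist_triangle (u := s) (v := t) (w := c)
  rw [G.dist_comm (u := t)] at h₃
  omega

/-- A vertex of `B` with a neighbor in a good clique `K` has a neighbor `x` and a
non-neighbor `y` in `K`. -/
theorem GoodClique.exists_adj_not_adj {V : Type*} {G : SimpleGraph V} {B C K : Set V}
    (hK : GoodClique G B C K) {b : V} (hb : b ∈ nbhd G K ∩ B) :
    ∃ x ∈ K, ∃ y ∈ K, G.Adj b x ∧ ¬ G.Adj b y ∧ G.Adj x y := by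
  obtain ⟨⟨x, hx, hxb⟩, hbB⟩ := hb
  have h := hK.2.2
  push Not at h
  obtain ⟨y, hy, hby⟩ := h b hbB
  refine ⟨x, hx, y, hy, hxb.symm, hby, hK.1.2.1 hx hy ?_⟩
  rintro rfl
  exact hby hxb.symm

end TD

theorem stmt9 {V : Type*} [Fintype V] (k : ℕ) (hk : 1 ≤ k)
    (G : SimpleGraph V) (hconn : G.Connected) (hfree : IndFree G (p4kp3 k))
    (A B C : Set V) (hA : Nonempty (G.induce A ≃g p4kp3 (k - 1)))
    (hB : B = {v | v ∉ A ∧ ∃ a ∈ A, G.Adj v a})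
    (hC : C = {v | v ∉ A ∧ v ∉ B})
    (Ks : Fin (k + 1) → Set V) (hreg : ∀ i, RegularClique G k B C (Ks i))
    (hdist : ∀ i j : Fin (k + 1), i ≠ j → 4 ≤ setDist G (Ks i) (Ks j))
    (i : Fin (k + 1)) (v : V) (hv : v ∉ closedNbhd G (Ks i))
    (b : V) (hb : b ∈ nbhd G (Ks i) ∩ B) (hvb : G.Adj v b) :
    ∃ j : Fin (k + 1), j ≠ i ∧ ∀ w ∈ nbhd G (Ks j) ∩ B, G.Adj v w := by
  by_contra hcon
  push Not at hcon
  have hBC : ∀ c ∈ C, c ∉ B := fun c hc => by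
    rw [hC] at hc
    exact hc.2
  obtain ⟨x, hx, y, hy, hbx, hby, hxy⟩ := (hreg i).1.exists_adj_not_adj hb
  have hvK : ∀ u ∈ Ks i, ¬ G.Adj v u := fun u hu hvu => hv (Or.inr ⟨u, hu, hvu.symm⟩)
  obtain ⟨p, hp0, hp1, hp2, hp3⟩ :=
    exists_pathGraph_four_embedding hvb hbx hxy (hvK x hx) (hvK y hy) hby
  have hdist_self : ∀ u : V, G.dist u u ≤ 1 := fun u => by simp
  have hdist_adj : ∀ {u u' : V}, G.Adj u u' → G.dist u u' ≤ 1 := fun h =>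
    (dist_eq_one_iff_adj.mpr h).le
  have hq : ∀ j : Fin (k + 1), j ≠ i → ∃ q : pathGraph 3 ↪g G,
      ¬ G.Adj v (q 0) ∧ (∀ n, ∃ u ∈ Ks j, G.dist u (q n) ≤ 1) ∧
        ∀ n, n ≠ 0 → ∃ u ∈ Ks j, G.dist u (q n) ≤ 0 := by
    intro j hj
    obtain ⟨w, hw, hvw⟩ := hcon j hj
    obtain ⟨x', hx', y', hy', hwx, hwy, hxy'⟩ := (hreg j).1.exists_adj_not_adj hw
    have hne : w ≠ y' := by
      rintro rfl
      exact hBC w ((hreg j).1.1.1 hy') hw.2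
    obtain ⟨q, hq0, hq1, hq2⟩ := exists_pathGraph_three_embedding_s9 hwx hxy' hwy hne
    refine ⟨q, hq0 ▸ hvw, fun n => ?_, fun n hn => ?_⟩
    · fin_cases n
      · exact ⟨x', hx', hq0 ▸ hdist_adj hwx.symm⟩
      · exact ⟨x', hx', hq1 ▸ hdist_self x'⟩
      · exact ⟨y', hy', hq2 ▸ hdist_self y'⟩
    · fin_cases n
      · exact absurd rfl hn
      · exact ⟨x', hx', hq1 ▸ dist_self.le⟩
      · exact ⟨y', hy', hq2 ▸ dist_self.le⟩
  choose q hqv hq1 hq0 using fun j : Fin k => hq (i.succAbove j) (Fin.succAbove_ne i j)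
  refine hfree (nonempty_p4kp3_embedding p q (fun m j n => ?_) fun j j' hj m n => ?_)
  · have hij := hdist i (i.succAbove j) (Fin.succAbove_ne i j).symm
    by_cases hm : m = 0
    · subst hm
      have hv2 : ∃ u ∈ Ks i, G.dist u (p 0) ≤ 2 := by
        refine ⟨x, hx, hp0 ▸ ?_⟩
        have := hconn.dist_triangle (u := x) (v := b) (w := v)
        have := hdist_adj hbx.symm
        have := hdist_adj hvb.symm
        omega
      by_cases hn : n = 0
      · subst hn
        have := le_dist_add_of_le_setDist hconn hij hv2 (hq1 j 0)
        refine ⟨fun h => ?_, hp0 ▸ hqv j⟩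
        rw [h, dist_self] at this
        omega
      · have := le_dist_add_of_le_setDist hconn hij hv2 (hq0 j n hn)
        exact ne_and_not_adj_of_two_le_dist (by omega)
    · have hm1 : ∃ u ∈ Ks i, G.dist u (p m) ≤ 1 := by
        fin_cases m
        · exact absurd rfl hm
        · exact ⟨x, hx, hp1 ▸ hdist_adj hbx.symm⟩
        · exact ⟨x, hx, hp2 ▸ hdist_self x⟩
        · exact ⟨y, hy, hp3 ▸ hdist_self y⟩
      have := le_dist_add_of_le_setDist hconn hij hm1 (hq1 j n)
      exact ne_and_not_adj_of_two_le_dist (by omega)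
  · have hjj := hdist (i.succAbove j) (i.succAbove j')
      (fun h => hj (Fin.succAbove_right_injective h))
    have := le_dist_add_of_le_setDist hconn hjj (hq1 j m) (hq1 j' n)
    exact ne_and_not_adj_of_two_le_dist (by omega)
end
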